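/- Let f ∈ L_p^0(T²), 1<p<∞, α₁,α₂>0, n₁,n₂ ∈ ℕ, and set θ=min(2,p), τ=max(2,p). For 1<s<∞ define 𝕀(s) = n₁^{−α₁}n₂^{−α₂}{Σ_{ν₁=1}^{n₁}Σ_{ν₂=1}^{n₂} ρ_{ν₁,ν₂}^s ν₁^{(α₁+1)s−2} ν₂^{(α₂+1)s−2}}^{1/s} + n₁^{−α₁}{Σ_{ν₁=1}^{n₁}Σ_{ν₂=n₂+1}^∞ ρ_{ν₁,ν₂}^s ν₁^{(α₁+1)s−2} ν₂^{s−2}}^{1/s} + n₂^{−α₂}{Σ_{ν₁=n₁+1}^∞Σ_{ν₂=1}^{n₂} ρ_{ν₁,ν₂}^s ν₁^{s−2} ν₂^{(α₂+1)s−2}}^{1/s} + {Σ_{ν₁=n₁+1}^∞Σ_{ν₂=n₂+1}^∞ ρ_{ν₁,ν₂}^s (ν₁ν₂)^{s−2}}^{1/s}. Then 𝕀(θ) ≲ ω_{α₁,α₂}(f, 1/n₁, 1/n₂)_p ≲ 𝕀(τ). -/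

import Mathlib

open MeasureTheory Real
open scoped ENNReal

noncomputable section

/-- The `L_p` norm of a function of two variables over the period square `(0,2π]²`. -/
def Lp2Norm (p : ℝ) (f : ℝ → ℝ → ℝ) : ℝ≥0∞ :=
  (∫⁻ x in Set.Ioc (0:ℝ) (2*π), ∫⁻ y in Set.Ioc (0:ℝ) (2*π),
      ENNReal.ofReal (|f x y| ^ p)) ^ (1/p)

/-- `f ∈ L_p^0(T²)`: measurable, `2π`-periodic in each variable, finite `L_p` norm,
and zero mean in each variable separately. -/
structure MemLp0 (p : ℝ) (f : ℝ → ℝ → ℝ) : Prop where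
  meas : Measurable (Function.uncurry f)
  periodic_x : ∀ y, Function.Periodic (fun x => f x y) (2*π)
  periodic_y : ∀ x, Function.Periodic (f x) (2*π)
  norm_ne_top : Lp2Norm p f ≠ ⊤
  mean_x : ∀ᵐ (y : ℝ) ∂volume, (∫ x in (0:ℝ)..(2*π), f x y) = 0
  mean_y : ∀ᵐ (x : ℝ) ∂volume, (∫ y in (0:ℝ)..(2*π), f x y) = 0

/-- Generalized (fractional) binomial coefficient `C(α,ν) = α(α-1)⋯(α-ν+1)/ν!`. -/
def fracBinom (α : ℝ) : ℕ → ℝ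
  | 0 => 1
  | n+1 => fracBinom α n * (α - (n : ℝ)) / ((n : ℝ) + 1)

/-- Fractional difference of order `α` with step `h` in the first variable. -/
def diffX (α h : ℝ) (f : ℝ → ℝ → ℝ) : ℝ → ℝ → ℝ :=
  fun x y => ∑' ν : ℕ, (-1 : ℝ) ^ ν * fracBinom α ν * f (x + (α - (ν : ℝ)) * h) y

/-- Fractional difference of order `α` with step `h` in the second variable. -/
def diffY (α h : ℝ) (f : ℝ → ℝ → ℝ) : ℝ → ℝ → ℝ :=
  fun x y => ∑' ν : ℕ, (-1 : ℝ) ^ ν * fracBinom α ν * f x (y + (α - (ν : ℝ)) * h)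

/-- The mixed (fractional) modulus of smoothness `ω_{α₁,α₂}(f, δ₁, δ₂)_p`. -/
def mixedMod (p α₁ α₂ δ₁ δ₂ : ℝ) (f : ℝ → ℝ → ℝ) : ℝ≥0∞ :=
  ⨆ (h₁ : ℝ) (_ : |h₁| ≤ δ₁) (h₂ : ℝ) (_ : |h₂| ≤ δ₂),
    Lp2Norm p (diffX α₁ h₁ (diffY α₂ h₂ f))

/-- Cosine-cosine Fourier coefficient `a_{n₁,n₂}` of `f`. -/
def fourierCC (f : ℝ → ℝ → ℝ) (n₁ n₂ : ℕ) : ℝ :=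
  (1/π^2) * ∫ x in (0:ℝ)..(2*π), ∫ y in (0:ℝ)..(2*π),
    f x y * Real.cos ((n₁ : ℝ) * x) * Real.cos ((n₂ : ℝ) * y)

/-- Sine-cosine Fourier coefficient `b_{n₁,n₂}` of `f`. -/
def fourierSC (f : ℝ → ℝ → ℝ) (n₁ n₂ : ℕ) : ℝ :=
  (1/π^2) * ∫ x in (0:ℝ)..(2*π), ∫ y in (0:ℝ)..(2*π),
    f x y * Real.sin ((n₁ : ℝ) * x) * Real.cos ((n₂ : ℝ) * y)

/-- Cosine-sine Fourier coefficient `c_{n₁,n₂}` of `f`. -/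
def fourierCS (f : ℝ → ℝ → ℝ) (n₁ n₂ : ℕ) : ℝ :=
  (1/π^2) * ∫ x in (0:ℝ)..(2*π), ∫ y in (0:ℝ)..(2*π),
    f x y * Real.cos ((n₁ : ℝ) * x) * Real.sin ((n₂ : ℝ) * y)

/-- Sine-sine Fourier coefficient `d_{n₁,n₂}` of `f`. -/
def fourierSS (f : ℝ → ℝ → ℝ) (n₁ n₂ : ℕ) : ℝ :=
  (1/π^2) * ∫ x in (0:ℝ)..(2*π), ∫ y in (0:ℝ)..(2*π),
    f x y * Real.sin ((n₁ : ℝ) * x) * Real.sin ((n₂ : ℝ) * y)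

/-- `ρ_{n₁,n₂} = |a_{n₁,n₂}| + |b_{n₁,n₂}| + |c_{n₁,n₂}| + |d_{n₁,n₂}|`. -/
def rhoCoef (f : ℝ → ℝ → ℝ) (n₁ n₂ : ℕ) : ℝ :=
  |fourierCC f n₁ n₂| + |fourierSC f n₁ n₂| + |fourierCS f n₁ n₂| + |fourierSS f n₁ n₂|

/-- The quantity `𝕀(s)` of Theorem 7.1. -/
def Ifun (f : ℝ → ℝ → ℝ) (α₁ α₂ : ℝ) (n₁ n₂ : ℕ) (s : ℝ) : ℝ≥0∞ :=
  ENNReal.ofReal ((n₁:ℝ) ^ (-α₁) * (n₂:ℝ) ^ (-α₂)) *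
    (∑ ν₁ ∈ Finset.Icc 1 n₁, ∑ ν₂ ∈ Finset.Icc 1 n₂,
      ENNReal.ofReal (rhoCoef f ν₁ ν₂ ^ s * (ν₁:ℝ) ^ ((α₁+1)*s-2) *
        (ν₂:ℝ) ^ ((α₂+1)*s-2))) ^ (1/s)
  + ENNReal.ofReal ((n₁:ℝ) ^ (-α₁)) *
    (∑ ν₁ ∈ Finset.Icc 1 n₁, ∑' k : ℕ,
      ENNReal.ofReal (rhoCoef f ν₁ (n₂+1+k) ^ s * (ν₁:ℝ) ^ ((α₁+1)*s-2) *
        ((n₂+1+k : ℕ) : ℝ) ^ (s-2))) ^ (1/s)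
  + ENNReal.ofReal ((n₂:ℝ) ^ (-α₂)) *
    (∑ ν₂ ∈ Finset.Icc 1 n₂, ∑' k : ℕ,
      ENNReal.ofReal (rhoCoef f (n₁+1+k) ν₂ ^ s * ((n₁+1+k : ℕ) : ℝ) ^ (s-2) *
        (ν₂:ℝ) ^ ((α₂+1)*s-2))) ^ (1/s)
  + (∑' (j : ℕ) (k : ℕ),
      ENNReal.ofReal (rhoCoef f (n₁+1+j) (n₂+1+k) ^ s * ((n₁+1+j : ℕ) : ℝ) ^ (s-2) *
        ((n₂+1+k : ℕ) : ℝ) ^ (s-2))) ^ (1/s)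

section Circle

open AddCircle Filter Topology

variable {T : ℝ} [hT : Fact (0 < T)]

theorem tsum_enorm_sq_fourierCoeff {g : AddCircle T → ℂ} (hg : MemLp g 2 haarAddCircle) :
    ∑' k : ℤ, ‖fourierCoeff g k‖ₑ ^ (2:ℝ) = ∫⁻ t, ‖g t‖ₑ ^ (2:ℝ) ∂haarAddCircle := by
  have hc : ∀ k, fourierCoeff (hg.toLp g) k = fourierCoeff g k := fun k =>
    congrFun (fourierCoeff_congr_ae hg.coeFn_toLp) k
  have h := hasSum_sq_fourierCoeff (hg.toLp g)
  simp only [hc] at h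
  have h1 : ∑' k : ℤ, ‖fourierCoeff g k‖ₑ ^ (2:ℝ)
      = ENNReal.ofReal (∑' k : ℤ, ‖fourierCoeff g k‖ ^ 2) := by
    rw [ENNReal.ofReal_tsum_of_nonneg (fun _ => by positivity) h.summable]
    refine tsum_congr fun k => ?_
    rw [ENNReal.rpow_two, ← ofReal_norm, ENNReal.ofReal_pow (norm_nonneg _)]
  have h2 : ∫ t, ‖hg.toLp g t‖ ^ 2 ∂haarAddCircle = ∫ t, ‖g t‖ ^ 2 ∂haarAddCircle := by
    refine integral_congr_ae ?_
    filter_upwards [hg.coeFn_toLp] with t ht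
    rw [ht]
  rw [h1, h.tsum_eq, h2, ofReal_integral_eq_lintegral_ofReal (hg.integrable_norm_pow two_ne_zero)
    (ae_of_all _ fun _ => by positivity)]
  refine lintegral_congr fun t => ?_
  rw [ENNReal.rpow_two, ← ofReal_norm, ENNReal.ofReal_pow (norm_nonneg _)]

theorem ae_eq_zero_of_fourierCoeff_eq_zero {g : AddCircle T → ℂ}
    (hg : Integrable g haarAddCircle) (h : ∀ k, fourierCoeff g k = 0) :
    g =ᵐ[haarAddCircle] 0 := by
  have hint : ∀ φ : C(AddCircle T, ℂ), Integrable (fun t => φ t * g t) haarAddCircle := fun φ =>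
    hg.bdd_mul φ.continuous.aestronglyMeasurable (ae_of_all _ fun t => φ.norm_coe_le_norm t)
  let L : C(AddCircle T, ℂ) →ₗ[ℂ] ℂ :=
    { toFun := fun φ => ∫ t, φ t * g t ∂haarAddCircle
      map_add' := fun φ ψ => by
        simp only [ContinuousMap.add_apply, add_mul]
        exact integral_add (hint φ) (hint ψ)
      map_smul' := fun c φ => by
        simp only [ContinuousMap.smul_apply, smul_eq_mul, mul_assoc, RingHom.id_apply]
        exact integral_const_mul c _ }
  have hL : Continuous L := by
    refine AddMonoidHomClass.continuous_of_bound L (∫ t, ‖g t‖ ∂haarAddCircle) fun φ => ?_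
    rw [mul_comm]
    calc ‖L φ‖ ≤ ∫ t, ‖φ t * g t‖ ∂haarAddCircle := norm_integral_le_integral_norm _
      _ ≤ ∫ t, ‖φ‖ * ‖g t‖ ∂haarAddCircle := by
          refine integral_mono (hint φ).norm (hg.norm.const_mul _) fun t => ?_
          rw [norm_mul]
          gcongr
          exact φ.norm_coe_le_norm t
      _ = _ := integral_const_mul _ _
  have hzero : ∀ φ, L φ = 0 := by
    intro φ
    have hmem : φ ∈ (Submodule.span ℂ (Set.range (fourier (T := T)))).topologicalClosure := by
      rw [span_fourier_closure_eq_top]; trivial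
    have hker : Submodule.span ℂ (Set.range (fourier (T := T))) ≤ LinearMap.ker L := by
      rw [Submodule.span_le]
      rintro _ ⟨k, rfl⟩
      have := h (-k)
      simpa [fourierCoeff, L] using this
    exact Submodule.topologicalClosure_minimal _ hker (isClosed_singleton.preimage hL) hmem
  refine ae_eq_zero_of_forall_setIntegral_isClosed_eq_zero hg fun s hs => ?_
  have hlim : Tendsto (fun n => ∫ t, ((hs.apprSeq n t : ℝ) : ℂ) * g t ∂haarAddCircle) atTop
      (𝓝 (∫ t, s.indicator g t ∂haarAddCircle)) := by
    refine tendsto_integral_of_dominated_convergence (fun t => ‖g t‖) (fun n => ?_) hg.norm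
      (fun n => ae_of_all _ fun t => ?_) (ae_of_all _ fun t => ?_)
    · refine AEStronglyMeasurable.mul (Continuous.aestronglyMeasurable ?_) hg.1
      fun_prop
    · rw [norm_mul]
      have : ‖((hs.apprSeq n t : ℝ) : ℂ)‖ ≤ 1 := by
        simpa using HasOuterApproxClosed.apprSeq_apply_le_one hs n t
      nlinarith [norm_nonneg (g t)]
    · have h1 := tendsto_pi_nhds.1 (HasOuterApproxClosed.tendsto_apprSeq hs) t
      have h2 : Tendsto (fun n => ((hs.apprSeq n t : ℝ) : ℂ)) atTop
          (𝓝 (((s.indicator (fun _ => (1 : NNReal)) t : NNReal) : ℝ) : ℂ)) :=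
        (Complex.continuous_ofReal.comp NNReal.continuous_coe).continuousAt.tendsto.comp h1
      convert h2.mul_const (g t) using 2
      by_cases ht : t ∈ s <;> simp [ht]
  have hz : ∀ n, ∫ t, ((hs.apprSeq n t : ℝ) : ℂ) * g t ∂haarAddCircle = 0 := fun n =>
    hzero ⟨fun t => ((hs.apprSeq n t : ℝ) : ℂ), by fun_prop⟩
  simp only [hz] at hlim
  rw [← integral_indicator hs.measurableSet]
  exact (tendsto_nhds_unique tendsto_const_nhds hlim).symm

theorem memLp_two_of_tsum_fourierCoeff_ne_top {g : AddCircle T → ℂ}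
    (hg : Integrable g haarAddCircle)
    (h : ∑' k : ℤ, ‖fourierCoeff g k‖ₑ ^ (2:ℝ) ≠ ⊤) : MemLp g 2 haarAddCircle := by
  have hs : Summable fun k => ‖fourierCoeff g k‖ ^ 2 := by
    have := ENNReal.summable_toReal h
    simpa [ENNReal.toReal_pow] using this
  have hmem : Memℓp (fun k => fourierCoeff g k) 2 := by
    refine memℓp_gen ?_
    simpa using hs
  let G := fourierBasis (T := T).repr.symm ⟨_, hmem⟩
  have hG : ∀ k, fourierCoeff G k = fourierCoeff g k := fun k => by
    rw [← fourierBasis_repr]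
    simp [G]
  have hGi : Integrable G haarAddCircle := (Lp.memLp G).integrable (by norm_num)
  have hz : (fun t => g t - G t) =ᵐ[haarAddCircle] 0 := by
    refine ae_eq_zero_of_fourierCoeff_eq_zero (hg.sub hGi) fun k => ?_
    have h1 : fourierCoeff (fun t => g t - G t) k = fourierCoeff g k - fourierCoeff G k := by
      simp only [fourierCoeff, smul_sub]
      exact integral_sub (hg.fourier_smul (-k)) (hGi.fourier_smul (-k))
    rw [h1, hG, sub_self]
  refine (memLp_congr_ae ?_).2 (Lp.memLp G)
  filter_upwards [hz] with t ht
  exact sub_eq_zero.1 ht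

theorem tsum_enorm_sq_fourierCoeff_of_integrable {g : AddCircle T → ℂ}
    (hg : Integrable g haarAddCircle) :
    ∑' k : ℤ, ‖fourierCoeff g k‖ₑ ^ (2:ℝ) = ∫⁻ t, ‖g t‖ₑ ^ (2:ℝ) ∂haarAddCircle := by
  by_cases h : MemLp g 2 haarAddCircle
  · exact tsum_enorm_sq_fourierCoeff h
  have h1 : ∑' k : ℤ, ‖fourierCoeff g k‖ₑ ^ (2:ℝ) = ⊤ := by
    by_contra h'
    exact h (memLp_two_of_tsum_fourierCoeff_ne_top hg h')
  have h2 : ∫⁻ t, ‖g t‖ₑ ^ (2:ℝ) ∂haarAddCircle = ⊤ := by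
    by_contra h'
    refine h ⟨hg.1, ?_⟩
    rw [eLpNorm_lt_top_iff_lintegral_rpow_enorm_lt_top (by norm_num) (by norm_num)]
    simpa using lt_top_iff_ne_top.2 h'
  rw [h1, h2]

end Circle

/-- The weight `1 + |k|` attached to the frequency `k`. -/
def freqWeight (k : ℤ) : ℝ := 1 + |(k : ℝ)|

theorem one_le_freqWeight (k : ℤ) : 1 ≤ freqWeight k := by
  unfold freqWeight; linarith [abs_nonneg (k : ℝ)]

theorem freqWeight_pos (k : ℤ) : 0 < freqWeight k := one_pos.trans_le (one_le_freqWeight k)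

/-- The discrete measure on `ℤ` giving mass `(1 + |k|)⁻²` to `k`. -/
def freqMeasure : Measure ℤ :=
  Measure.count.withDensity fun k => ENNReal.ofReal (freqWeight k ^ (-2 : ℝ))

theorem lintegral_freqMeasure (F : ℤ → ℝ≥0∞) :
    ∫⁻ k, F k ∂freqMeasure = ∑' k, ENNReal.ofReal (freqWeight k ^ (-2 : ℝ)) * F k := by
  rw [freqMeasure, lintegral_withDensity_eq_lintegral_mul _ (measurable_of_countable _)
    (measurable_of_countable _), lintegral_count]
  rfl

theorem tsum_nat_indicator_inv_sq_le {s : ℝ} (hs : 0 < s) :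
    ∑' n : ℕ, (if s < (n : ℝ) + 1 then ENNReal.ofReal (((n : ℝ) + 1) ^ (-2 : ℝ)) else 0) ≤
      ENNReal.ofReal (2 / s) := by
  rw [ENNReal.tsum_eq_iSup_nat]
  refine iSup_le fun N => ?_
  calc ∑ n ∈ Finset.range N,
        (if s < (n : ℝ) + 1 then ENNReal.ofReal (((n : ℝ) + 1) ^ (-2 : ℝ)) else 0)
      = ∑ n ∈ (Finset.range N).filter (fun n : ℕ => s < (n : ℝ) + 1),
          ENNReal.ofReal (((n + 1 : ℕ) : ℝ) ^ 2)⁻¹ := by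
        rw [Finset.sum_filter]
        refine Finset.sum_congr rfl fun n _ => ?_
        have : ((n : ℝ) + 1) ^ (-2 : ℝ) = (((n + 1 : ℕ) : ℝ) ^ 2)⁻¹ := by
          rw [Real.rpow_neg (by positivity)]; push_cast; norm_cast
        rw [this]
    _ = ∑ m ∈ ((Finset.range N).filter (fun n : ℕ => s < (n : ℝ) + 1)).image Nat.succ,
          ENNReal.ofReal ((m : ℝ) ^ 2)⁻¹ := by
        rw [Finset.sum_image Nat.succ_injective.injOn]
    _ ≤ ∑ m ∈ Finset.Ioo ⌊s⌋₊ (N + 1), ENNReal.ofReal ((m : ℝ) ^ 2)⁻¹ := by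
        refine Finset.sum_le_sum_of_subset fun m hm => ?_
        simp only [Finset.mem_image, Finset.mem_filter, Finset.mem_range] at hm
        obtain ⟨n, ⟨h1, h2⟩, rfl⟩ := hm
        rw [Finset.mem_Ioo, Nat.floor_lt hs.le]
        exact ⟨by push_cast; exact h2, by omega⟩
    _ = ENNReal.ofReal (∑ m ∈ Finset.Ioo ⌊s⌋₊ (N + 1), ((m : ℝ) ^ 2)⁻¹) :=
        (ENNReal.ofReal_sum_of_nonneg fun _ _ => by positivity).symm
    _ ≤ ENNReal.ofReal (2 / s) := by
        refine ENNReal.ofReal_le_ofReal ((sum_Ioo_inv_sq_le _ _).trans ?_)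
        exact div_le_div_of_nonneg_left (by norm_num) hs (Nat.lt_floor_add_one s).le

theorem freqMeasure_lt_freqWeight_le {s : ℝ} (hs : 0 < s) :
    freqMeasure {k | s < freqWeight k} ≤ ENNReal.ofReal (4 / s) := by
  have h0 := tsum_nat_indicator_inv_sq_le hs
  have h1 : freqMeasure {k | s < freqWeight k} = ∑' k : ℤ,
      (if s < freqWeight k then ENNReal.ofReal (freqWeight k ^ (-2 : ℝ)) else 0) := by
    rw [← lintegral_indicator_one (MeasurableSet.of_discrete), lintegral_freqMeasure]
    refine tsum_congr fun k => ?_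
    by_cases h : s < freqWeight k <;> simp [h]
  have h2 : ENNReal.ofReal (4 / s) = ENNReal.ofReal (2 / s) + ENNReal.ofReal (2 / s) := by
    rw [← ENNReal.ofReal_add (by positivity) (by positivity)]; congr 1; ring
  rw [h1, tsum_of_nat_of_neg_add_one ENNReal.summable ENNReal.summable, h2]
  have hw : ∀ n : ℕ, freqWeight (n : ℤ) = (n : ℝ) + 1 := fun n => by
    simp [freqWeight, add_comm]
  have hw' : ∀ n : ℕ, freqWeight (-((n : ℤ) + 1)) = ((n + 1 : ℕ) : ℝ) + 1 := fun n => by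
    unfold freqWeight; push_cast; rw [abs_neg, abs_of_nonneg (by positivity)]; ring
  refine add_le_add ?_ ?_
  · simpa only [hw] using h0
  · simp only [hw']
    exact (ENNReal.tsum_comp_le_tsum_of_injective (add_left_injective 1)
      (fun n : ℕ => if s < (n : ℝ) + 1 then ENNReal.ofReal (((n : ℝ) + 1) ^ (-2 : ℝ)) else 0)).trans
      h0

theorem lintegral_Ioi_indicator_rpow_of_lt {r q : ℝ} (hr : 0 < r) (hq : q < -1) :
    ∫⁻ t in Set.Ioi (0 : ℝ), (if r ≤ t then ENNReal.ofReal (t ^ q) else 0) =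
      ENNReal.ofReal (r ^ (q + 1) / (-(q + 1))) := by
  have h : (fun t : ℝ => if r ≤ t then ENNReal.ofReal (t ^ q) else 0) =
      (Set.Ici r).indicator fun t => ENNReal.ofReal (t ^ q) := by
    ext t; by_cases h : r ≤ t <;> simp [h]
  rw [h, lintegral_indicator measurableSet_Ici, Measure.restrict_restrict measurableSet_Ici,
    Set.inter_eq_left.2 (Set.Ici_subset_Ioi.2 hr), ← restrict_Ioi_eq_restrict_Ici,
    ← ofReal_integral_eq_lintegral_ofReal (integrableOn_Ioi_rpow_of_lt hq hr),
    integral_Ioi_rpow_of_lt hq hr]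
  · congr 1; rw [div_neg, neg_div]
  · refine (ae_restrict_iff' measurableSet_Ioi).2 (ae_of_all _ fun t ht => ?_)
    exact Real.rpow_nonneg (hr.trans ht).le _

theorem lintegral_Ioi_indicator_rpow_of_gt {r q : ℝ} (hr : 0 < r) (hq : -1 < q) :
    ∫⁻ t in Set.Ioi (0 : ℝ), (if t < r then ENNReal.ofReal (t ^ q) else 0) =
      ENNReal.ofReal (r ^ (q + 1) / (q + 1)) := by
  have h : (fun t : ℝ => if t < r then ENNReal.ofReal (t ^ q) else 0) =
      (Set.Iio r).indicator fun t => ENNReal.ofReal (t ^ q) := by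
    ext t; by_cases h : t < r <;> simp [h]
  rw [h, lintegral_indicator measurableSet_Iio, Measure.restrict_restrict measurableSet_Iio,
    Set.inter_comm, Set.Ioi_inter_Iio, restrict_Ioo_eq_restrict_Ioc,
    ← ofReal_integral_eq_lintegral_ofReal, ← intervalIntegral.integral_of_le hr.le,
    integral_rpow (Or.inl hq), Real.zero_rpow (by linarith), sub_zero]
  · exact (intervalIntegral.intervalIntegrable_rpow' hq).1
  · refine (ae_restrict_iff' measurableSet_Ioc).2 (ae_of_all _ fun t ht => ?_)
    exact Real.rpow_nonneg ht.1.le _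

section Paley

open AddCircle

variable {T : ℝ} [hT : Fact (0 < T)]

theorem enorm_fourierCoeff_le_lintegral (g : AddCircle T → ℂ) (k : ℤ) :
    ‖fourierCoeff g k‖ₑ ≤ ∫⁻ x, ‖g x‖ₑ ∂haarAddCircle := by
  refine (enorm_integral_le_lintegral_enorm _).trans_eq (lintegral_congr fun x => ?_)
  rw [smul_eq_mul, enorm_mul]
  have : ‖fourier (-k) x‖ₑ = 1 := by
    rw [← ofReal_norm, fourier_apply, Circle.norm_coe, ENNReal.ofReal_one]
  rw [this, one_mul]

theorem freqMeasure_lt_mul_norm_fourierCoeff_le_sq {g : AddCircle T → ℂ}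
    (hg : Integrable g haarAddCircle) {t : ℝ} (ht : 0 < t) :
    freqMeasure {k | t / 2 < freqWeight k * ‖fourierCoeff g k‖} ≤
      ENNReal.ofReal (4 * t ^ (-2 : ℝ)) * ∫⁻ x, ‖g x‖ₑ ^ (2 : ℝ) ∂haarAddCircle := by
  have hF : ∫⁻ k, ENNReal.ofReal ((freqWeight k * ‖fourierCoeff g k‖) ^ 2) ∂freqMeasure =
      ∫⁻ x, ‖g x‖ₑ ^ (2 : ℝ) ∂haarAddCircle := by
    rw [← tsum_enorm_sq_fourierCoeff_of_integrable hg, lintegral_freqMeasure]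
    refine tsum_congr fun k => ?_
    have hk := freqWeight_pos k
    rw [← ENNReal.ofReal_mul (by positivity), Real.rpow_neg hk.le, Real.rpow_two,
      ← ofReal_norm, ENNReal.rpow_two, ← ENNReal.ofReal_pow (norm_nonneg _)]
    congr 1; field_simp
  have hε : ENNReal.ofReal ((t / 2) ^ 2) ≠ 0 := by
    rw [Ne, ENNReal.ofReal_eq_zero, not_le]; positivity
  have := meas_ge_le_lintegral_div (μ := freqMeasure)
    (f := fun k => ENNReal.ofReal ((freqWeight k * ‖fourierCoeff g k‖) ^ 2))
    (measurable_of_countable _).aemeasurable hε ENNReal.ofReal_ne_top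
  rw [hF] at this
  calc _ ≤ _ := measure_mono fun k hk => ?_
    _ ≤ _ := this
    _ = _ := ?_
  · exact ENNReal.ofReal_le_ofReal (pow_le_pow_left₀ (by positivity) (le_of_lt hk) 2)
  · rw [ENNReal.div_eq_inv_mul, ← ENNReal.ofReal_inv_of_pos (by positivity),
      Real.rpow_neg ht.le, Real.rpow_two]
    congr 2; field_simp; norm_num

theorem freqMeasure_lt_mul_norm_fourierCoeff_le {g : AddCircle T → ℂ}
    (hg : Integrable g haarAddCircle) {t : ℝ} (ht : 0 < t) :
    freqMeasure {k | t / 2 < freqWeight k * ‖fourierCoeff g k‖} ≤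
      ENNReal.ofReal (8 * t ^ (-1 : ℝ)) * ∫⁻ x, ‖g x‖ₑ ∂haarAddCircle := by
  set A := ∫ x, ‖g x‖ ∂haarAddCircle
  have hA : ∫⁻ x, ‖g x‖ₑ ∂haarAddCircle = ENNReal.ofReal A :=
    (ofReal_integral_norm_eq_lintegral_enorm hg).symm
  have hA0 : 0 ≤ A := integral_nonneg fun _ => norm_nonneg _
  have hle : ∀ k, ‖fourierCoeff g k‖ ≤ A := fun k => by
    have := enorm_fourierCoeff_le_lintegral g k
    rwa [hA, ← ofReal_norm, ENNReal.ofReal_le_ofReal_iff hA0] at this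
  rw [hA, ← ENNReal.ofReal_mul (by positivity)]
  rcases hA0.eq_or_lt with h0 | h0
  · have : {k | t / 2 < freqWeight k * ‖fourierCoeff g k‖} = ∅ := by
      ext k
      have h1 : ‖fourierCoeff g k‖ = 0 := le_antisymm (h0 ▸ hle k) (norm_nonneg _)
      simp [h1]; positivity
    simp [this]
  · calc _ ≤ freqMeasure {k | t / 2 / A < freqWeight k} := measure_mono fun k hk => ?_
      _ ≤ _ := freqMeasure_lt_freqWeight_le (by positivity)
      _ = _ := ?_
    · have hk' : t / 2 < freqWeight k * ‖fourierCoeff g k‖ := hk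
      rw [Set.mem_ofPred_eq, div_lt_iff₀ h0]
      exact hk'.trans_le (mul_le_mul_of_nonneg_left (hle k) (freqWeight_pos k).le)
    · rw [Real.rpow_neg_one]; congr 1; field_simp; norm_num

theorem freqMeasure_level_le {g : AddCircle T → ℂ} (hm : StronglyMeasurable g)
    (hg : Integrable g haarAddCircle) {t : ℝ} (ht : 0 < t) :
    freqMeasure {k | t < freqWeight k * ‖fourierCoeff g k‖} ≤
      ENNReal.ofReal (4 * t ^ (-2 : ℝ)) *
        ∫⁻ x, (if ‖g x‖ ≤ t then ‖g x‖ₑ ^ (2 : ℝ) else 0) ∂haarAddCircle +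
      ENNReal.ofReal (8 * t ^ (-1 : ℝ)) *
        ∫⁻ x, (if t < ‖g x‖ then ‖g x‖ₑ else 0) ∂haarAddCircle := by
  have hs : MeasurableSet {x | ‖g x‖ ≤ t} := hm.norm.measurable measurableSet_Iic
  set u := {x | ‖g x‖ ≤ t}.indicator g with hu
  set v := {x | ‖g x‖ ≤ t}ᶜ.indicator g with hv
  have hui : Integrable u haarAddCircle := hg.indicator hs
  have hvi : Integrable v haarAddCircle := hg.indicator hs.compl
  have hadd : ∀ k, fourierCoeff g k = fourierCoeff u k + fourierCoeff v k := fun k => by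
    have h1 : g = u + v := (Set.indicator_self_add_compl _ g).symm
    conv_lhs => rw [h1]
    exact congrFun (fourierCoeff.add hui hvi) k
  have h1 : ∀ x, (if ‖g x‖ ≤ t then ‖g x‖ₑ ^ (2 : ℝ) else 0) = ‖u x‖ₑ ^ (2 : ℝ) := fun x => by
    by_cases h : ‖g x‖ ≤ t <;> simp [hu, h]
  have h2 : ∀ x, (if t < ‖g x‖ then ‖g x‖ₑ else 0) = ‖v x‖ₑ := fun x => by
    by_cases h : t < ‖g x‖
    · simp [hv, h]
    · simp [hv, h, not_lt.1 h]
  simp only [h1, h2]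
  refine le_trans ((measure_mono fun k hk => ?_).trans (measure_union_le _ _))
    (add_le_add (freqMeasure_lt_mul_norm_fourierCoeff_le_sq hui ht)
      (freqMeasure_lt_mul_norm_fourierCoeff_le hvi ht))
  have hk' : t < freqWeight k * ‖fourierCoeff g k‖ := hk
  by_contra hcon
  simp only [Set.mem_union, Set.mem_ofPred_eq, not_or, not_lt] at hcon
  have h3 : freqWeight k * ‖fourierCoeff g k‖ ≤
      freqWeight k * (‖fourierCoeff u k‖ + ‖fourierCoeff v k‖) := by
    rw [hadd]
    exact mul_le_mul_of_nonneg_left (norm_add_le _ _) (freqWeight_pos k).le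
  linarith [hcon.1, hcon.2]

end Paley

section Paley

open AddCircle

variable {T : ℝ} [hT : Fact (0 < T)]

theorem lintegral_Ioi_truncation_eq {p r : ℝ} (hp : 1 < p) (hp2 : p < 2) (hr : 0 < r) :
    ∫⁻ t in Set.Ioi (0 : ℝ),
      (ENNReal.ofReal (4 * r ^ (2 : ℝ)) * (if r ≤ t then ENNReal.ofReal (t ^ (p - 3)) else 0) +
        ENNReal.ofReal (8 * r) * (if t < r then ENNReal.ofReal (t ^ (p - 2)) else 0)) =
      ENNReal.ofReal ((4 / (2 - p) + 8 / (p - 1)) * r ^ p) := by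
  rw [lintegral_add_left, lintegral_const_mul, lintegral_const_mul,
    lintegral_Ioi_indicator_rpow_of_lt hr (by linarith),
    lintegral_Ioi_indicator_rpow_of_gt hr (by linarith),
    ← ENNReal.ofReal_mul (by positivity), ← ENNReal.ofReal_mul (by positivity),
    ← ENNReal.ofReal_add]
  · congr 1
    have h1 : r ^ p = r ^ (2 : ℝ) * r ^ (p - 3 + 1) := by
      rw [← Real.rpow_add hr]; congr 1; ring
    have h2 : r ^ p = r * r ^ (p - 2 + 1) := by
      rw [← Real.rpow_one_add' hr.le (by linarith)]; congr 1; ring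
    rw [add_mul]
    congr 1
    · rw [h1, show -(p - 3 + 1) = 2 - p by ring]; ring
    · rw [h2, show p - 2 + 1 = p - 1 by ring]; ring
  · have : 0 < -(p - 3 + 1) := by linarith
    positivity
  · have : 0 < p - 2 + 1 := by linarith
    positivity
  all_goals
    first
    | exact Measurable.ite measurableSet_Iio (by fun_prop) measurable_const
    | exact Measurable.ite measurableSet_Ici (by fun_prop) measurable_const
    | exact (Measurable.ite measurableSet_Ici (by fun_prop) measurable_const).const_mul _

/-- The Hardy–Littlewood–Paley inequality for a strongly measurable representative. -/
theorem paley_aux {p : ℝ} (hp : 1 < p) (hp2 : p < 2)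
    {g : AddCircle T → ℂ} (hm : StronglyMeasurable g) (hg : Integrable g haarAddCircle) :
    ∑' k : ℤ, ENNReal.ofReal (freqWeight k ^ (p - 2)) * ‖fourierCoeff g k‖ₑ ^ p ≤
      ENNReal.ofReal (p * (4 / (2 - p) + 8 / (p - 1))) *
        ∫⁻ x, ‖g x‖ₑ ^ p ∂haarAddCircle := by
  have hgm : Measurable fun x => ‖g x‖ := hm.norm.measurable
  have hge : Measurable fun x => ‖g x‖ₑ := hm.enorm
  set K : ℝ → AddCircle T → ℝ≥0∞ := fun t x =>
    ENNReal.ofReal (4 * ‖g x‖ ^ (2 : ℝ)) *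
        (if ‖g x‖ ≤ t then ENNReal.ofReal (t ^ (p - 3)) else 0) +
      ENNReal.ofReal (8 * ‖g x‖) * (if t < ‖g x‖ then ENNReal.ofReal (t ^ (p - 2)) else 0) with hK
  have hL : ∑' k : ℤ, ENNReal.ofReal (freqWeight k ^ (p - 2)) * ‖fourierCoeff g k‖ₑ ^ p =
      ∫⁻ k, ENNReal.ofReal ((freqWeight k * ‖fourierCoeff g k‖) ^ p) ∂freqMeasure := by
    rw [lintegral_freqMeasure]
    refine tsum_congr fun k => ?_
    have hk := freqWeight_pos k
    rw [Real.mul_rpow hk.le (norm_nonneg _), ← ENNReal.ofReal_mul (by positivity), ← mul_assoc,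
      ← Real.rpow_add hk, ← ofReal_norm, ENNReal.ofReal_rpow_of_nonneg (norm_nonneg _) (by linarith),
      ← ENNReal.ofReal_mul (by positivity)]
    congr 4; ring
  have hlevel : ∀ t ∈ Set.Ioi (0 : ℝ),
      freqMeasure {k | t < freqWeight k * ‖fourierCoeff g k‖} * ENNReal.ofReal (t ^ (p - 1)) ≤
        ∫⁻ x, K t x ∂haarAddCircle := by
    intro t ht
    have ht' : 0 < t := ht
    refine (mul_le_mul_left (freqMeasure_level_le hm hg ht) _).trans_eq ?_
    rw [add_mul, mul_right_comm, mul_right_comm (ENNReal.ofReal (8 * _)),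
      ← ENNReal.ofReal_mul (by positivity), ← ENNReal.ofReal_mul (by positivity),
      mul_assoc 4, mul_assoc 8, ← Real.rpow_add ht', ← Real.rpow_add ht',
      ← lintegral_const_mul, ← lintegral_const_mul, ← lintegral_add_left]
    · refine lintegral_congr fun x => ?_
      simp only [hK]
      congr 1
      · by_cases h : ‖g x‖ ≤ t
        · simp only [h, if_true]
          rw [← ofReal_norm, ENNReal.ofReal_rpow_of_nonneg (norm_nonneg _) (by norm_num),
            ← ENNReal.ofReal_mul (by positivity), ← ENNReal.ofReal_mul (by positivity)]
          congr 1
          rw [show -2 + (p - 1) = p - 3 by ring]; ring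
        · simp [h]
      · by_cases h : t < ‖g x‖
        · simp only [h, if_true]
          rw [← ofReal_norm,
            ← ENNReal.ofReal_mul (by positivity), ← ENNReal.ofReal_mul (by positivity)]
          congr 1
          rw [show -1 + (p - 1) = p - 2 by ring]; ring
        · simp [h]
    all_goals
      first
      | exact (Measurable.ite (hgm measurableSet_Iic) (by fun_prop) measurable_const).const_mul _
      | exact Measurable.ite (hgm measurableSet_Ioi) (by fun_prop) measurable_const
      | exact Measurable.ite (hgm measurableSet_Iic) (by fun_prop) measurable_const
  have hpt : ∀ x, ∫⁻ t in Set.Ioi (0 : ℝ), K t x ≤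
      ENNReal.ofReal (4 / (2 - p) + 8 / (p - 1)) * ‖g x‖ₑ ^ p := by
    intro x
    have h2p : 0 < 2 - p := by linarith
    have h1p : 0 < p - 1 := by linarith
    rcases (norm_nonneg (g x)).eq_or_lt with h | h
    · have h0 : g x = 0 := norm_eq_zero.1 h.symm
      have : ∀ t, K t x = 0 := fun t => by simp [hK, h0]
      simp [this]
    · rw [lintegral_Ioi_truncation_eq hp hp2 h, ← ofReal_norm,
        ENNReal.ofReal_rpow_of_nonneg (norm_nonneg _) (by linarith),
        ← ENNReal.ofReal_mul (by positivity)]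
  have hKm : Measurable (Function.uncurry K) := by
    have h1 : Measurable fun z : ℝ × AddCircle T => ‖g z.2‖ := hgm.comp measurable_snd
    refine Measurable.add (Measurable.mul (by fun_prop) ?_) (Measurable.mul (by fun_prop) ?_)
    · exact Measurable.ite (measurableSet_le h1 measurable_fst) (by fun_prop) measurable_const
    · exact Measurable.ite (measurableSet_lt measurable_fst h1) (by fun_prop) measurable_const
  rw [hL, lintegral_rpow_eq_lintegral_meas_lt_mul freqMeasure
    (ae_of_all _ fun k => mul_nonneg (freqWeight_pos k).le (norm_nonneg _))
    (measurable_of_countable _).aemeasurable (by linarith), ENNReal.ofReal_mul (by linarith),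
    mul_assoc]
  refine mul_le_mul_right ?_ _
  refine (setLIntegral_mono' measurableSet_Ioi hlevel).trans ?_
  rw [lintegral_lintegral_swap hKm.aemeasurable, ← lintegral_const_mul _ (by fun_prop)]
  exact lintegral_mono hpt

/-- The Hardy–Littlewood–Paley inequality on the circle, for exponents `1 < p ≤ 2`. -/
theorem exists_paley {p : ℝ} (hp : 1 < p) (hp2 : p ≤ 2) :
    ∃ C : ℝ, 0 < C ∧ ∀ g : AddCircle T → ℂ, Integrable g haarAddCircle →
      ∑' k : ℤ, ENNReal.ofReal (freqWeight k ^ (p - 2)) * ‖fourierCoeff g k‖ₑ ^ p ≤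
        ENNReal.ofReal C * ∫⁻ x, ‖g x‖ₑ ^ p ∂haarAddCircle := by
  rcases hp2.eq_or_lt with rfl | hp2
  · refine ⟨1, one_pos, fun g hg => ?_⟩
    simpa using (tsum_enorm_sq_fourierCoeff_of_integrable hg).le
  · have h2p : 0 < 2 - p := by linarith
    have h1p : 0 < p - 1 := by linarith
    refine ⟨p * (4 / (2 - p) + 8 / (p - 1)), by positivity, fun g hg => ?_⟩
    have hae := hg.1.ae_eq_mk
    have h := paley_aux hp hp2 hg.1.stronglyMeasurable_mk (hg.congr hae)
    rw [← fourierCoeff_congr_ae hae] at h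
    refine h.trans_eq ?_
    congr 1
    refine lintegral_congr_ae ?_
    filter_upwards [hae] with x hx
    rw [hx]

end Paley

theorem tsum_ofReal_freqWeight_rpow_neg_two_ne_top :
    ∑' k : ℤ, ENNReal.ofReal (freqWeight k ^ (-2 : ℝ)) ≠ ⊤ := by
  have h := freqMeasure_lt_freqWeight_le (s := 1 / 2) (by norm_num)
  have h1 : {k | (1 / 2 : ℝ) < freqWeight k} = Set.univ :=
    Set.eq_univ_of_forall fun k => by
      have := one_le_freqWeight k
      rw [Set.mem_ofPred_eq]; linarith
  rw [h1, ← lintegral_one, lintegral_freqMeasure] at h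
  simp only [mul_one] at h
  exact ne_top_of_le_ne_top ENNReal.ofReal_ne_top h

/-- Hölder's inequality for series of extended nonnegative reals. -/
theorem ENNReal.tsum_mul_le_rpow_mul_rpow {ι : Type*} {p q : ℝ} (hpq : p.HolderConjugate q)
    (f g : ι → ℝ≥0∞) :
    ∑' i, f i * g i ≤ (∑' i, f i ^ p) ^ (1 / p) * (∑' i, g i ^ q) ^ (1 / q) := by
  let _ : MeasurableSpace ι := ⊤
  have := ENNReal.lintegral_mul_le_Lp_mul_Lq (Measure.count : Measure ι) hpq
    (f := f) (g := g) (measurable_from_top).aemeasurable (measurable_from_top).aemeasurable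
  have hd : MeasurableSingletonClass ι := ⟨fun _ => trivial⟩
  simpa only [lintegral_count, Pi.mul_apply] using this

section Paley

open AddCircle

variable {T : ℝ} [hT : Fact (0 < T)]

theorem enorm_integral_conj_mul_le_tsum {h g : AddCircle T → ℂ}
    (hh : MemLp h 2 haarAddCircle) (hg : MemLp g 2 haarAddCircle) :
    ‖∫ x, (starRingEnd ℂ) (h x) * g x ∂haarAddCircle‖ₑ ≤
      ∑' k : ℤ, ‖fourierCoeff g k‖ₑ * ‖fourierCoeff h k‖ₑ := by
  have hi := (fourierBasis (T := T)).hasSum_inner_mul_inner (hh.toLp h) (hg.toLp g)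
  have h1 : ∀ (u : AddCircle T → ℂ) (hu : MemLp u 2 haarAddCircle) (k : ℤ),
      inner ℂ (fourierBasis (T := T) k) (hu.toLp u) = fourierCoeff u k := fun u hu k => by
    rw [← HilbertBasis.repr_apply_apply, fourierBasis_repr]
    exact congrFun (fourierCoeff_congr_ae hu.coeFn_toLp) k
  have h2 : inner ℂ (hh.toLp h) (hg.toLp g) =
      ∫ x, (starRingEnd ℂ) (h x) * g x ∂haarAddCircle := by
    rw [L2.inner_def]
    refine integral_congr_ae ?_
    filter_upwards [hh.coeFn_toLp, hg.coeFn_toLp] with x hx hx'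
    rw [hx, hx', RCLike.inner_apply']
  rw [← h2, ← hi.tsum_eq]
  refine (enorm_tsum_le_tsum_enorm).trans_eq (tsum_congr fun k => ?_)
  rw [enorm_mul, h1 g hg, ← inner_conj_symm, h1 h hh, mul_comm]
  congr 1
  rw [← ofReal_norm, ← ofReal_norm, RCLike.norm_conj]

theorem memLp_two_of_tsum_weight_ne_top {p : ℝ} (hp : 2 < p) {g : AddCircle T → ℂ}
    (hg : Integrable g haarAddCircle)
    (h : ∑' k : ℤ, ENNReal.ofReal (freqWeight k ^ (p - 2)) * ‖fourierCoeff g k‖ₑ ^ p ≠ ⊤) :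
    MemLp g 2 haarAddCircle := by
  refine memLp_two_of_tsum_fourierCoeff_ne_top hg (ne_top_of_le_ne_top
    (ENNReal.add_ne_top.2 ⟨h, tsum_ofReal_freqWeight_rpow_neg_two_ne_top⟩) ?_)
  rw [← ENNReal.tsum_add]
  refine ENNReal.tsum_le_tsum fun k => ?_
  have hk := freqWeight_pos k
  set a := ‖fourierCoeff g k‖ with ha
  have ha0 : 0 ≤ a := norm_nonneg _
  rw [← ofReal_norm, ENNReal.ofReal_rpow_of_nonneg ha0 (by norm_num),
    ENNReal.ofReal_rpow_of_nonneg ha0 (by linarith), ← ENNReal.ofReal_mul (by positivity),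
    ← ENNReal.ofReal_add (by positivity) (by positivity)]
  refine ENNReal.ofReal_le_ofReal ?_
  rcases le_total (freqWeight k * a) 1 with h1 | h1
  · have h2 : a ≤ (freqWeight k)⁻¹ := by rwa [← one_div, le_div_iff₀' hk]
    have h3 : a ^ (2 : ℝ) ≤ freqWeight k ^ (-2 : ℝ) := by
      rw [Real.rpow_neg hk.le, ← Real.inv_rpow hk.le]
      exact Real.rpow_le_rpow ha0 h2 (by norm_num)
    have : 0 ≤ freqWeight k ^ (p - 2) * a ^ p := by positivity
    linarith
  · have ha' : 0 < a := by
      rcases ha0.eq_or_lt with h0 | h0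
      · rw [← h0] at h1; norm_num at h1
      · exact h0
    have h2 : freqWeight k ^ (p - 2) * a ^ p = (freqWeight k * a) ^ (p - 2) * a ^ (2 : ℝ) := by
      rw [Real.mul_rpow hk.le ha0, mul_assoc, ← Real.rpow_add ha']; congr 2; ring
    have h3 : 1 ≤ (freqWeight k * a) ^ (p - 2) := Real.one_le_rpow h1 (by linarith)
    have h4 : 0 ≤ freqWeight k ^ (-2 : ℝ) := by positivity
    have h5 : 0 ≤ a ^ (2 : ℝ) := by positivity
    have h6 := mul_le_mul_of_nonneg_right h3 h5
    rw [h2]; linarith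

theorem ENNReal.le_rpow_mul_of_le_mul_rpow {p q : ℝ} (hpq : p.HolderConjugate q)
    {I S C : ℝ≥0∞} (hI : I ≠ ⊤) (h : I ≤ S ^ (1 / p) * (C * I) ^ (1 / q)) :
    I ≤ C ^ (p - 1) * S := by
  rcases eq_or_ne I 0 with h0 | h0
  · simp [h0]
  have hp := hpq.pos
  have hq := hpq.symm.pos
  have hpos : 0 < I ^ (1 / q) := ENNReal.rpow_pos (pos_iff_ne_zero.2 h0) hI
  have hfin : I ^ (1 / q) ≠ ⊤ := ENNReal.rpow_ne_top_of_nonneg (by positivity) hI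
  have h1 : I = I ^ (1 / p) * I ^ (1 / q) := by
    rw [← ENNReal.rpow_add _ _ h0 hI, one_div, one_div, hpq.inv_add_inv_eq_one, ENNReal.rpow_one]
  rw [ENNReal.mul_rpow_of_nonneg _ _ (by positivity), ← mul_assoc] at h
  nth_rw 1 [h1] at h
  have h2 : I ^ (1 / p) ≤ S ^ (1 / p) * C ^ (1 / q) :=
    (ENNReal.mul_le_mul_iff_left hpos.ne' hfin).1 h
  have h3 := ENNReal.rpow_le_rpow h2 hp.le
  rw [← ENNReal.rpow_mul, one_div_mul_cancel hp.ne', ENNReal.rpow_one,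
    ENNReal.mul_rpow_of_nonneg _ _ hp.le, ← ENNReal.rpow_mul, one_div_mul_cancel hp.ne',
    ENNReal.rpow_one, ← ENNReal.rpow_mul, mul_comm] at h3
  have h4 : 1 / q * p = p - 1 := by
    have := hpq.inv_add_inv_eq_one
    have h5 : q⁻¹ = 1 - p⁻¹ := by linarith
    rw [one_div, h5, sub_mul, inv_mul_cancel₀ hp.ne', one_mul]
  rwa [h4] at h3

theorem paley_dual_truncated {p q C : ℝ} (hp : 2 < p) (hpq : p.HolderConjugate q)
    (hC : ∀ g : AddCircle T → ℂ, Integrable g haarAddCircle →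
      ∑' k : ℤ, ENNReal.ofReal (freqWeight k ^ (q - 2)) * ‖fourierCoeff g k‖ₑ ^ q ≤
        ENNReal.ofReal C * ∫⁻ x, ‖g x‖ₑ ^ q ∂haarAddCircle)
    {g : AddCircle T → ℂ} (hm : StronglyMeasurable g) (hg : MemLp g 2 haarAddCircle) (N : ℕ) :
    ∫⁻ x, (if ‖g x‖ ≤ N then ‖g x‖ₑ ^ p else 0) ∂haarAddCircle ≤
      ENNReal.ofReal C ^ (p - 1) *
        ∑' k : ℤ, ENNReal.ofReal (freqWeight k ^ (p - 2)) * ‖fourierCoeff g k‖ₑ ^ p := by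
  have hp0 : 0 < p := hpq.pos
  have hq0 : 0 < q := hpq.symm.pos
  have hgm : Measurable fun x => ‖g x‖ := hm.norm.measurable
  have hset : MeasurableSet {x | ‖g x‖ ≤ N} := hgm measurableSet_Iic
  set h : AddCircle T → ℂ :=
    {x | ‖g x‖ ≤ N}.indicator fun x => ((‖g x‖ ^ (p - 2) : ℝ) : ℂ) * g x with hh
  have hhm : StronglyMeasurable h := by
    refine StronglyMeasurable.indicator ?_ hset
    exact ((Complex.measurable_ofReal.comp (hgm.pow_const _)).mul hm.measurable).stronglyMeasurable
  have hnorm : ∀ x, ‖h x‖ = if ‖g x‖ ≤ N then ‖g x‖ ^ (p - 1) else 0 := fun x => by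
    by_cases hx : ‖g x‖ ≤ N
    · simp only [hh, Set.indicator_of_mem (show x ∈ {x | ‖g x‖ ≤ N} from hx), hx, if_true, norm_mul,
        Complex.norm_real, Real.norm_of_nonneg (Real.rpow_nonneg (norm_nonneg _) _)]
      rw [← Real.rpow_add_one' (norm_nonneg _) (by linarith)]
      congr 1; ring
    · simp [hh, hx]
  have hbd : ∀ x, ‖h x‖ ≤ (N : ℝ) ^ (p - 1) := fun x => by
    rw [hnorm]
    split_ifs with hx
    · exact Real.rpow_le_rpow (norm_nonneg _) hx (by linarith)
    · positivity
  have hh2 : MemLp h 2 haarAddCircle :=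
    MemLp.of_bound hhm.aestronglyMeasurable _ (ae_of_all _ hbd)
  have hhi : Integrable h haarAddCircle := hh2.integrable (by norm_num)
  set I := ∫⁻ x, (if ‖g x‖ ≤ N then ‖g x‖ₑ ^ p else 0) ∂haarAddCircle with hI
  have hIreal : ∀ x, (if ‖g x‖ ≤ N then ‖g x‖ₑ ^ p else 0) =
      ENNReal.ofReal (if ‖g x‖ ≤ N then ‖g x‖ ^ p else 0) := fun x => by
    split_ifs
    · rw [← ofReal_norm, ENNReal.ofReal_rpow_of_nonneg (norm_nonneg _) hp0.le]
    · simp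
  have hIfin : I ≠ ⊤ := by
    refine ne_top_of_le_ne_top (b := ENNReal.ofReal ((N : ℝ) ^ p)) ENNReal.ofReal_ne_top ?_
    calc I ≤ ∫⁻ _, ENNReal.ofReal ((N : ℝ) ^ p) ∂(haarAddCircle (T := T)) := by
          refine lintegral_mono fun x => ?_
          simp only [hIreal]
          refine ENNReal.ofReal_le_ofReal ?_
          split_ifs with hx
          · exact Real.rpow_le_rpow (norm_nonneg _) hx hp0.le
          · positivity
      _ = _ := by simp
  have hIint : I = ‖∫ x, (starRingEnd ℂ) (h x) * g x ∂haarAddCircle‖ₑ := by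
    have h1 : ∀ x, (starRingEnd ℂ) (h x) * g x =
        ((if ‖g x‖ ≤ N then ‖g x‖ ^ p else 0 : ℝ) : ℂ) := fun x => by
      by_cases hx : ‖g x‖ ≤ N
      · simp only [hh, Set.indicator_of_mem (show x ∈ {x | ‖g x‖ ≤ N} from hx), hx, if_true,
          map_mul, Complex.conj_ofReal, mul_assoc, Complex.conj_mul']
        rw [← Complex.ofReal_pow, ← Complex.ofReal_mul, ← Real.rpow_two,
          ← Real.rpow_add' (norm_nonneg _) (by linarith)]
        congr 2; ring
      · simp [hh, hx]
    have h2 : ∀ x, 0 ≤ (if ‖g x‖ ≤ N then ‖g x‖ ^ p else 0 : ℝ) := fun x => by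
      split_ifs <;> positivity
    simp only [h1, integral_complex_ofReal]
    rw [← ofReal_norm, Complex.norm_real,
      Real.norm_of_nonneg (integral_nonneg h2), ofReal_integral_eq_lintegral_ofReal]
    · simp only [hI, hIreal]
    · refine Integrable.of_bound (C := (N : ℝ) ^ p)
        (Measurable.ite hset (by fun_prop) measurable_const).aestronglyMeasurable
        (ae_of_all _ fun x => ?_)
      rw [Real.norm_of_nonneg (h2 x)]
      split_ifs with hx
      · exact Real.rpow_le_rpow (norm_nonneg _) hx hp0.le
      · positivity
    · exact ae_of_all _ h2
  have hhq : ∫⁻ x, ‖h x‖ₑ ^ q ∂haarAddCircle = I := by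
    refine lintegral_congr fun x => ?_
    rw [hIreal, ← ofReal_norm, hnorm]
    split_ifs
    · rw [ENNReal.ofReal_rpow_of_nonneg (by positivity) hq0.le, ← Real.rpow_mul (norm_nonneg _),
        hpq.sub_one_mul_conj]
    · simp [hq0]
  have hHolder : ∑' k : ℤ, ‖fourierCoeff g k‖ₑ * ‖fourierCoeff h k‖ₑ ≤
      (∑' k : ℤ, ENNReal.ofReal (freqWeight k ^ (p - 2)) * ‖fourierCoeff g k‖ₑ ^ p) ^ (1 / p) *
      (∑' k : ℤ, ENNReal.ofReal (freqWeight k ^ (q - 2)) * ‖fourierCoeff h k‖ₑ ^ q) ^ (1 / q) := by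
    refine le_trans (le_of_eq ?_) ((ENNReal.tsum_mul_le_rpow_mul_rpow hpq
      (fun k => ENNReal.ofReal (freqWeight k ^ ((p - 2) / p)) * ‖fourierCoeff g k‖ₑ)
      (fun k => ENNReal.ofReal (freqWeight k ^ ((q - 2) / q)) * ‖fourierCoeff h k‖ₑ)).trans_eq ?_)
    · refine tsum_congr fun k => ?_
      have hk := freqWeight_pos k
      rw [mul_mul_mul_comm, ← ENNReal.ofReal_mul (by positivity), ← Real.rpow_add hk]
      have : (p - 2) / p + (q - 2) / q = 0 := by
        have := hpq.inv_add_inv_eq_one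
        rw [sub_div, sub_div, div_self hp0.ne', div_self hq0.ne', div_eq_mul_inv, div_eq_mul_inv]
        linarith
      simp [this]
    · have hpow : ∀ r : ℝ, 0 < r → ∀ (k : ℤ) (c : ℂ),
          (ENNReal.ofReal (freqWeight k ^ ((r - 2) / r)) * ‖c‖ₑ) ^ r =
          ENNReal.ofReal (freqWeight k ^ (r - 2)) * ‖c‖ₑ ^ r := fun r hr k c => by
        have hk := freqWeight_pos k
        rw [ENNReal.mul_rpow_of_nonneg _ _ hr.le,
          ENNReal.ofReal_rpow_of_nonneg (by positivity) hr.le, ← Real.rpow_mul hk.le,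
          div_mul_cancel₀ _ hr.ne']
      simp only [hpow p hp0, hpow q hq0]
  refine ENNReal.le_rpow_mul_of_le_mul_rpow hpq hIfin ?_
  calc I = _ := hIint
    _ ≤ _ := enorm_integral_conj_mul_le_tsum hh2 hg
    _ ≤ _ := hHolder
    _ ≤ _ := by
        gcongr
        exact (hC h hhi).trans_eq (by rw [hhq])

/-- The dual Hardy–Littlewood–Paley inequality on the circle, for exponents `p ≥ 2`. -/
theorem exists_paley_dual {p : ℝ} (hp : 2 ≤ p) :
    ∃ C : ℝ, 0 < C ∧ ∀ g : AddCircle T → ℂ, Integrable g haarAddCircle →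
      ∫⁻ x, ‖g x‖ₑ ^ p ∂haarAddCircle ≤ ENNReal.ofReal C *
        ∑' k : ℤ, ENNReal.ofReal (freqWeight k ^ (p - 2)) * ‖fourierCoeff g k‖ₑ ^ p := by
  rcases hp.eq_or_lt with rfl | hp
  · refine ⟨1, one_pos, fun g hg => ?_⟩
    simpa using (tsum_enorm_sq_fourierCoeff_of_integrable hg).ge
  have hpq : p.HolderConjugate (p / (p - 1)) := Real.HolderConjugate.conjExponent (by linarith)
  have hq2 : p / (p - 1) ≤ 2 := by rw [div_le_iff₀ (by linarith)]; linarith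
  obtain ⟨C, hC0, hC⟩ := exists_paley (T := T) hpq.symm.lt hq2
  refine ⟨C ^ (p - 1), by positivity, fun g hg => ?_⟩
  rw [← ENNReal.ofReal_rpow_of_pos hC0]
  by_cases hS : ∑' k : ℤ, ENNReal.ofReal (freqWeight k ^ (p - 2)) * ‖fourierCoeff g k‖ₑ ^ p = ⊤
  · rw [hS, ENNReal.mul_top]
    · exact le_top
    · rw [ENNReal.ofReal_rpow_of_pos hC0, Ne, ENNReal.ofReal_eq_zero, not_le]; positivity
  have hae := hg.1.ae_eq_mk
  have hg2 := (memLp_congr_ae hae).1 (memLp_two_of_tsum_weight_ne_top hp hg hS)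
  have h := paley_dual_truncated hp hpq hC hg.1.stronglyMeasurable_mk hg2
  rw [← fourierCoeff_congr_ae hae] at h
  set G := hg.1.mk g
  have hGm : Measurable fun x => ‖G x‖ := hg.1.stronglyMeasurable_mk.norm.measurable
  have h1 : ∫⁻ x, ‖g x‖ₑ ^ p ∂haarAddCircle =
      ∫⁻ x, ⨆ N : ℕ, (if ‖G x‖ ≤ N then ‖G x‖ₑ ^ p else 0) ∂haarAddCircle := by
    refine lintegral_congr_ae ?_
    filter_upwards [hae] with x hx
    rw [hx]
    refine le_antisymm ?_ (iSup_le fun N => ?_)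
    · obtain ⟨N, hN⟩ := exists_nat_ge ‖G x‖
      exact le_iSup_of_le N (by rw [if_pos hN])
    · split_ifs <;> simp
  rw [h1, lintegral_iSup]
  · exact iSup_le h
  · intro N
    exact Measurable.ite (hGm measurableSet_Iic)
      (hg.1.stronglyMeasurable_mk.enorm.pow_const _) measurable_const
  · intro M N hMN x
    dsimp only
    split_ifs with h1 h2
    · exact le_rfl
    · exact absurd (h1.trans (by exact_mod_cast hMN)) h2
    · simp
    · simp

end Paley

section Torus

open AddCircle

variable {T : ℝ} [hT : Fact (0 < T)]

/-- Fourier coefficients of a function on the two-dimensional torus. -/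
def torusCoeff (u : AddCircle T × AddCircle T → ℂ) (k l : ℤ) : ℂ :=
  fourierCoeff (fun a => fourierCoeff (fun b => u (a, b)) l) k

theorem integrable_fourierCoeff_right {u : AddCircle T × AddCircle T → ℂ}
    (hu : Integrable u (haarAddCircle.prod haarAddCircle)) (l : ℤ) :
    Integrable (fun a => fourierCoeff (fun b => u (a, b)) l) haarAddCircle := by
  have : Integrable (fun z : AddCircle T × AddCircle T => fourier (-l) z.2 • u z)
      (haarAddCircle.prod haarAddCircle) := by
    refine hu.bdd_smul (φ := fun z : AddCircle T × AddCircle T => (fourier (-l) z.2 : ℂ)) 1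
      (Continuous.aestronglyMeasurable (by fun_prop)) (ae_of_all _ fun z => ?_)
    rw [fourier_apply, Circle.norm_coe]
  exact this.integral_prod_left

theorem exists_torus_paley {p : ℝ} (hp : 1 < p) (hp2 : p ≤ 2) :
    ∃ C : ℝ, 0 < C ∧ ∀ u : AddCircle T × AddCircle T → ℂ,
      Integrable u (haarAddCircle.prod haarAddCircle) →
      ∑' (k : ℤ) (l : ℤ), ENNReal.ofReal (freqWeight k ^ (p - 2)) *
        (ENNReal.ofReal (freqWeight l ^ (p - 2)) * ‖torusCoeff u k l‖ₑ ^ p) ≤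
      ENNReal.ofReal C * ∫⁻ z, ‖u z‖ₑ ^ p ∂(haarAddCircle.prod haarAddCircle) := by
  obtain ⟨C, hC, hP⟩ := exists_paley (T := T) hp hp2
  refine ⟨C * C, by positivity, fun u hu => ?_⟩
  have hG := integrable_fourierCoeff_right hu
  rw [ENNReal.tsum_comm]
  calc ∑' (l : ℤ) (k : ℤ), ENNReal.ofReal (freqWeight k ^ (p - 2)) *
        (ENNReal.ofReal (freqWeight l ^ (p - 2)) * ‖torusCoeff u k l‖ₑ ^ p)
      = ∑' l : ℤ, ENNReal.ofReal (freqWeight l ^ (p - 2)) *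
          ∑' k : ℤ, ENNReal.ofReal (freqWeight k ^ (p - 2)) * ‖torusCoeff u k l‖ₑ ^ p := by
        simp_rw [← ENNReal.tsum_mul_left]
        exact tsum_congr fun l => tsum_congr fun k => mul_left_comm _ _ _
    _ ≤ ∑' l : ℤ, ENNReal.ofReal (freqWeight l ^ (p - 2)) * (ENNReal.ofReal C *
          ∫⁻ a, ‖fourierCoeff (fun b => u (a, b)) l‖ₑ ^ p ∂haarAddCircle) := by
        gcongr with l
        exact hP _ (hG l)
    _ = ENNReal.ofReal C * ∫⁻ a, ∑' l : ℤ, ENNReal.ofReal (freqWeight l ^ (p - 2)) *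
          ‖fourierCoeff (fun b => u (a, b)) l‖ₑ ^ p ∂haarAddCircle := by
        rw [lintegral_tsum fun l =>
          ((hG l).aestronglyMeasurable.enorm.pow_const p).const_mul _, ← ENNReal.tsum_mul_left]
        refine tsum_congr fun l => ?_
        rw [lintegral_const_mul'' _ ((hG l).aestronglyMeasurable.enorm.pow_const p),
          mul_left_comm]
    _ ≤ ENNReal.ofReal C * ∫⁻ a, ENNReal.ofReal C * ∫⁻ b, ‖u (a, b)‖ₑ ^ p ∂haarAddCircle
          ∂haarAddCircle := by
        gcongr 1
        refine lintegral_mono_ae ?_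
        filter_upwards [hu.prod_right_ae] with a ha using hP _ ha
    _ = _ := by
        rw [lintegral_const_mul' _ _ ENNReal.ofReal_ne_top, ← mul_assoc,
          ← ENNReal.ofReal_mul hC.le, lintegral_prod _ (hu.aestronglyMeasurable.enorm.pow_const p)]

theorem exists_torus_paley_dual {p : ℝ} (hp : 2 ≤ p) :
    ∃ C : ℝ, 0 < C ∧ ∀ u : AddCircle T × AddCircle T → ℂ,
      Integrable u (haarAddCircle.prod haarAddCircle) →
      ∫⁻ z, ‖u z‖ₑ ^ p ∂(haarAddCircle.prod haarAddCircle) ≤ ENNReal.ofReal C *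
      ∑' (k : ℤ) (l : ℤ), ENNReal.ofReal (freqWeight k ^ (p - 2)) *
        (ENNReal.ofReal (freqWeight l ^ (p - 2)) * ‖torusCoeff u k l‖ₑ ^ p) := by
  obtain ⟨C, hC, hP⟩ := exists_paley_dual (T := T) hp
  refine ⟨C * C, by positivity, fun u hu => ?_⟩
  have hG := integrable_fourierCoeff_right hu
  rw [ENNReal.tsum_comm]
  calc ∫⁻ z, ‖u z‖ₑ ^ p ∂(haarAddCircle.prod haarAddCircle)
      = ∫⁻ a, ∫⁻ b, ‖u (a, b)‖ₑ ^ p ∂haarAddCircle ∂haarAddCircle :=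
        lintegral_prod _ (hu.aestronglyMeasurable.enorm.pow_const p)
    _ ≤ ∫⁻ a, ENNReal.ofReal C * ∑' l : ℤ, ENNReal.ofReal (freqWeight l ^ (p - 2)) *
          ‖fourierCoeff (fun b => u (a, b)) l‖ₑ ^ p ∂haarAddCircle := by
        refine lintegral_mono_ae ?_
        filter_upwards [hu.prod_right_ae] with a ha using hP _ ha
    _ = ∑' l : ℤ, ENNReal.ofReal (freqWeight l ^ (p - 2)) * (ENNReal.ofReal C *
          ∫⁻ a, ‖fourierCoeff (fun b => u (a, b)) l‖ₑ ^ p ∂haarAddCircle) := by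
        rw [lintegral_const_mul' _ _ ENNReal.ofReal_ne_top, lintegral_tsum fun l =>
          ((hG l).aestronglyMeasurable.enorm.pow_const p).const_mul _, ← ENNReal.tsum_mul_left]
        refine tsum_congr fun l => ?_
        rw [lintegral_const_mul'' _ ((hG l).aestronglyMeasurable.enorm.pow_const p),
          mul_left_comm]
    _ ≤ ∑' l : ℤ, ENNReal.ofReal (freqWeight l ^ (p - 2)) * (ENNReal.ofReal C *
          (ENNReal.ofReal C * ∑' k : ℤ, ENNReal.ofReal (freqWeight k ^ (p - 2)) *
            ‖torusCoeff u k l‖ₑ ^ p)) := by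
        gcongr with l
        exact hP _ (hG l)
    _ = _ := by
        rw [← ENNReal.tsum_mul_left]
        refine tsum_congr fun l => ?_
        rw [← mul_assoc (ENNReal.ofReal C), ← ENNReal.ofReal_mul hC.le, mul_left_comm,
          ← ENNReal.tsum_mul_left]
        congr 1
        exact tsum_congr fun k => mul_left_comm _ _ _

/-- The weighted `ℓ_s` norm of the Fourier coefficients which controls the `L_p` norm. -/
def torusSum (s : ℝ) (c : ℤ → ℤ → ℂ) : ℝ≥0∞ :=
  ∑' (k : ℤ) (l : ℤ), ENNReal.ofReal (freqWeight k ^ (s - 2)) *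
    (ENNReal.ofReal (freqWeight l ^ (s - 2)) * ‖c k l‖ₑ ^ s)

theorem torusSum_two_eq {u : AddCircle T × AddCircle T → ℂ}
    (hu : Integrable u (haarAddCircle.prod haarAddCircle)) :
    torusSum 2 (torusCoeff u) = ∫⁻ z, ‖u z‖ₑ ^ (2 : ℝ) ∂(haarAddCircle.prod haarAddCircle) := by
  have hG := integrable_fourierCoeff_right hu
  rw [lintegral_prod _ (hu.aestronglyMeasurable.enorm.pow_const _)]
  have : ∫⁻ a, ∫⁻ b, ‖u (a, b)‖ₑ ^ (2 : ℝ) ∂haarAddCircle ∂haarAddCircle =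
      ∫⁻ a, ∑' l : ℤ, ‖fourierCoeff (fun b => u (a, b)) l‖ₑ ^ (2 : ℝ) ∂haarAddCircle := by
    refine lintegral_congr_ae ?_
    filter_upwards [hu.prod_right_ae] with a ha
      using (tsum_enorm_sq_fourierCoeff_of_integrable ha).symm
  rw [this, lintegral_tsum fun l => (hG l).aestronglyMeasurable.enorm.pow_const _, torusSum,
    ENNReal.tsum_comm]
  refine tsum_congr fun l => ?_
  rw [← tsum_enorm_sq_fourierCoeff_of_integrable (hG l)]
  simp [torusCoeff]

theorem exists_torusSum_le_eLpNorm {p : ℝ} (hp : 1 < p) :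
    ∃ C : ℝ, 0 < C ∧ ∀ u : AddCircle T × AddCircle T → ℂ,
      Integrable u (haarAddCircle.prod haarAddCircle) →
      torusSum (min 2 p) (torusCoeff u) ^ (1 / min 2 p) ≤
        ENNReal.ofReal C * eLpNorm' u p (haarAddCircle.prod haarAddCircle) := by
  rcases le_total p 2 with h2 | h2
  · obtain ⟨C, hC, h⟩ := exists_torus_paley (T := T) hp h2
    refine ⟨C ^ (1 / p), by positivity, fun u hu => ?_⟩
    have hp0 : 0 ≤ 1 / p := by positivity
    rw [min_eq_right h2, eLpNorm', ← ENNReal.ofReal_rpow_of_nonneg hC.le hp0,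
      ← ENNReal.mul_rpow_of_nonneg _ _ hp0]
    exact ENNReal.rpow_le_rpow (h u hu) hp0
  · refine ⟨1, one_pos, fun u hu => ?_⟩
    rw [min_eq_left h2, torusSum_two_eq hu, ENNReal.ofReal_one, one_mul]
    exact eLpNorm'_le_eLpNorm'_of_exponent_le (by norm_num) h2 _ hu.aestronglyMeasurable

theorem exists_eLpNorm_le_torusSum {p : ℝ} (hp : 1 < p) :
    ∃ C : ℝ, 0 < C ∧ ∀ u : AddCircle T × AddCircle T → ℂ,
      Integrable u (haarAddCircle.prod haarAddCircle) →
      eLpNorm' u p (haarAddCircle.prod haarAddCircle) ≤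
      ENNReal.ofReal C * torusSum (max 2 p) (torusCoeff u) ^ (1 / max 2 p) := by
  rcases le_total p 2 with h2 | h2
  · refine ⟨1, one_pos, fun u hu => ?_⟩
    rw [max_eq_left h2, torusSum_two_eq hu, ENNReal.ofReal_one, one_mul]
    exact eLpNorm'_le_eLpNorm'_of_exponent_le (by linarith) h2 _ hu.aestronglyMeasurable
  · obtain ⟨C, hC, h⟩ := exists_torus_paley_dual (T := T) h2
    refine ⟨C ^ (1 / p), by positivity, fun u hu => ?_⟩
    have hp0 : 0 ≤ 1 / p := by positivity
    rw [max_eq_right h2, eLpNorm', ← ENNReal.ofReal_rpow_of_nonneg hC.le hp0,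
      ← ENNReal.mul_rpow_of_nonneg _ _ hp0]
    exact ENNReal.rpow_le_rpow (h u hu) hp0

end Torus

section ShiftSeries

variable {G : Type*} [AddCommGroup G] [MeasurableSpace G] [MeasurableAdd G] {μ : Measure G}
  [μ.IsAddRightInvariant] {c : ℕ → ℂ} {u : G → ℂ}

theorem tsum_lintegral_shift_ne_top (hc : Summable fun ν => ‖c ν‖) (s : ℕ → G)
    (hu : Integrable u μ) : ∑' ν, ∫⁻ t, ‖c ν * u (t + s ν)‖ₑ ∂μ ≠ ⊤ := by
  have h : ∀ ν, ∫⁻ t, ‖c ν * u (t + s ν)‖ₑ ∂μ = ‖c ν‖ₑ * ∫⁻ t, ‖u t‖ₑ ∂μ := fun ν => by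
    simp_rw [enorm_mul]
    rw [lintegral_const_mul' _ _ enorm_ne_top,
      lintegral_add_right_eq_self (fun t => ‖u t‖ₑ) (s ν)]
  simp_rw [h]
  rw [ENNReal.tsum_mul_right]
  exact ENNReal.mul_ne_top (tsum_enorm_ne_top_iff_summable_norm.2 hc) hu.2.ne

theorem integrable_shiftSeries (hc : Summable fun ν => ‖c ν‖) (s : ℕ → G)
    (hu : Integrable u μ) : Integrable (fun t => ∑' ν, c ν * u (t + s ν)) μ := by
  have hm : ∀ ν, AEMeasurable (fun t => c ν * u (t + s ν)) μ := fun ν =>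
    ((hu.comp_add_right (s ν)).const_mul (c ν)).aestronglyMeasurable.aemeasurable
  refine ⟨(AEMeasurable.tsum hm).aestronglyMeasurable, ?_⟩
  calc ∫⁻ t, ‖∑' ν, c ν * u (t + s ν)‖ₑ ∂μ
      ≤ ∫⁻ t, ∑' ν, ‖c ν * u (t + s ν)‖ₑ ∂μ := lintegral_mono fun t => enorm_tsum_le_tsum_enorm
    _ = ∑' ν, ∫⁻ t, ‖c ν * u (t + s ν)‖ₑ ∂μ := lintegral_tsum fun ν => (hm ν).enorm
    _ < ⊤ := (tsum_lintegral_shift_ne_top hc s hu).lt_top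

theorem integral_character_mul_shiftSeries (hc : Summable fun ν => ‖c ν‖) (s : ℕ → G)
    (hu : Integrable u μ) {χ : G → ℂ} (hχm : AEStronglyMeasurable χ μ) (hχ1 : ∀ t, ‖χ t‖ = 1)
    (hχ : ∀ t t', χ (t + t') = χ t * χ t') :
    ∫ t, χ t * ∑' ν, c ν * u (t + s ν) ∂μ = (∑' ν, c ν * (χ (s ν))⁻¹) * ∫ t, χ t * u t ∂μ := by
  have hm : ∀ ν, AEStronglyMeasurable (fun t => χ t * (c ν * u (t + s ν))) μ := fun ν =>
    hχm.mul ((hu.comp_add_right (s ν)).const_mul (c ν)).aestronglyMeasurable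
  simp_rw [← tsum_mul_left]
  rw [integral_tsum hm, ← tsum_mul_right]
  · refine tsum_congr fun ν => ?_
    have h : ∀ t, χ t * (c ν * u (t + s ν)) =
        c ν * (χ (s ν))⁻¹ * (χ (t + s ν) * u (t + s ν)) := fun t => by
      have : χ (s ν) ≠ 0 := norm_ne_zero_iff.1 (by rw [hχ1]; norm_num)
      rw [hχ]; field_simp
    simp_rw [h]
    rw [integral_const_mul, integral_add_right_eq_self (fun t => χ t * u t) (s ν)]
  · have : ∀ ν t, ‖χ t * (c ν * u (t + s ν))‖ₑ = ‖c ν * u (t + s ν)‖ₑ := fun ν t => by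
      rw [enorm_mul, ← ofReal_norm (χ t), hχ1]; simp
    simp_rw [this]
    exact tsum_lintegral_shift_ne_top hc s hu

end ShiftSeries

section Binomial

open Filter Topology

theorem fracBinom_eq_choose (α : ℝ) (n : ℕ) : fracBinom α n = Ring.choose α n := by
  induction n with
  | zero => simp [fracBinom]
  | succ n ih =>
    have h := Ring.descPochhammer_eq_factorial_smul_choose α (n + 1)
    have h' := Ring.descPochhammer_eq_factorial_smul_choose α n
    rw [descPochhammer_succ_right, Polynomial.smeval_mul, h'] at h
    rw [fracBinom, ih]
    simp only [Polynomial.smeval_sub, Polynomial.smeval_X, pow_one, Polynomial.smeval_natCast,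
      pow_zero, nsmul_eq_mul, mul_one, Nat.factorial_succ, Nat.cast_mul, Nat.cast_add,
      Nat.cast_one] at h
    have h1 : (n.factorial : ℝ) ≠ 0 := by positivity
    have h2 : (n : ℝ) + 1 ≠ 0 := by positivity
    rw [div_eq_iff h2]
    refine mul_left_cancel₀ h1 ?_
    linarith

theorem summable_abs_fracBinom {α : ℝ} (hα : 0 < α) : Summable fun ν => |fracBinom α ν| := by
  obtain ⟨N, hN⟩ := exists_nat_gt α
  have hstep : ∀ ν, N ≤ ν → α * |fracBinom α ν| =
      ν * |fracBinom α ν| - (ν + 1 : ℕ) * |fracBinom α (ν + 1)| := fun ν hν => by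
    have h1 : α - ν ≤ 0 := by
      have : (N : ℝ) ≤ ν := by exact_mod_cast hν
      linarith
    have h2 : (0 : ℝ) < ν + 1 := by positivity
    rw [fracBinom, abs_div, abs_mul, abs_of_nonpos h1, abs_of_pos h2]
    push_cast
    field_simp
    ring
  rw [← summable_nat_add_iff N]
  refine summable_of_sum_range_le (c := N * |fracBinom α N| / α) (fun _ => abs_nonneg _)
    fun n => ?_
  have hsum : α * ∑ i ∈ Finset.range n, |fracBinom α (i + N)| =
      N * |fracBinom α N| - (n + N : ℕ) * |fracBinom α (n + N)| := by
    induction n with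
    | zero => simp
    | succ n ih =>
      rw [Finset.sum_range_succ, mul_add, ih, hstep _ (by omega), show n + N + 1 = n + 1 + N by ring]
      ring
  rw [le_div_iff₀ hα, mul_comm, hsum]
  have : 0 ≤ ((n + N : ℕ) : ℝ) * |fracBinom α (n + N)| := by positivity
  linarith

theorem hasSum_fracBinom_of_norm_lt_one (α : ℝ) {z : ℂ} (hz : ‖z‖ < 1) :
    HasSum (fun ν => (fracBinom α ν : ℂ) * z ^ ν) ((1 + z) ^ (α : ℂ)) := by
  have h := (Complex.one_add_cpow_hasFPowerSeriesOnBall_zero (a := (α : ℂ))).hasSum (y := z)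
    (by simpa [← ofReal_norm] using hz)
  simpa [binomialSeries, FormalMultilinearSeries.coeff_ofScalars, fracBinom_eq_choose, Complex.ofReal_choose, mul_comm] using h

theorem norm_tsum_fracBinom {α : ℝ} (hα : 0 < α) {z : ℂ} (hz : ‖z‖ = 1) :
    ‖∑' ν, (fracBinom α ν : ℂ) * z ^ ν‖ = ‖1 + z‖ ^ α := by
  have hlim : Tendsto (fun r : ℝ => ∑' ν, (fracBinom α ν : ℂ) * ((r : ℂ) * z) ^ ν) (𝓝[<] 1)
      (𝓝 (∑' ν, (fracBinom α ν : ℂ) * z ^ ν)) := by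
    refine tendsto_tsum_of_dominated_convergence (summable_abs_fracBinom hα) (fun ν => ?_) ?_
    · have : Continuous fun r : ℝ => (fracBinom α ν : ℂ) * ((r : ℂ) * z) ^ ν := by fun_prop
      simpa using (this.tendsto 1).mono_left nhdsWithin_le_nhds
    · filter_upwards [Ioo_mem_nhdsLT (zero_lt_one (α := ℝ))] with r hr ν
      rw [norm_mul, norm_pow, norm_mul, hz, mul_one, Complex.norm_real, Complex.norm_real,
        Real.norm_of_nonneg hr.1.le, Real.norm_eq_abs]
      exact mul_le_of_le_one_right (abs_nonneg _) (pow_le_one₀ hr.1.le hr.2.le)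
  have hlim' : Tendsto (fun r : ℝ => ‖1 + (r : ℂ) * z‖ ^ α) (𝓝[<] 1) (𝓝 (‖1 + z‖ ^ α)) := by
    have : Continuous fun r : ℝ => ‖1 + (r : ℂ) * z‖ ^ α :=
      Continuous.rpow_const (by fun_prop) fun _ => Or.inr hα.le
    simpa using (this.tendsto 1).mono_left nhdsWithin_le_nhds
  refine tendsto_nhds_unique (hlim.norm.congr' ?_) hlim'
  filter_upwards [Ioo_mem_nhdsLT (zero_lt_one (α := ℝ))] with r hr
  have hr1 : ‖(r : ℂ) * z‖ < 1 := by
    rw [norm_mul, hz, mul_one, Complex.norm_real, Real.norm_of_nonneg hr.1.le]; exact hr.2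
  rw [(hasSum_fracBinom_of_norm_lt_one α hr1).tsum_eq, Complex.norm_cpow_real]

end Binomial

section Symbol

theorem norm_tsum_fracBinom_mul_exp {α : ℝ} (hα : 0 < α) (φ : ℝ) :
    ‖∑' ν : ℕ, ((-1) ^ ν * fracBinom α ν : ℂ) * Complex.exp (((α - ν) * φ : ℝ) * Complex.I)‖ =
      |2 * Real.sin (φ / 2)| ^ α := by
  set z : ℂ := -Complex.exp ((-φ : ℝ) * Complex.I) with hz
  have hz1 : ‖z‖ = 1 := by rw [hz, norm_neg, Complex.norm_exp_ofReal_mul_I]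
  have h : ∀ ν : ℕ, ((-1) ^ ν * fracBinom α ν : ℂ) *
      Complex.exp (((α - ν) * φ : ℝ) * Complex.I) =
      Complex.exp ((α * φ : ℝ) * Complex.I) * ((fracBinom α ν : ℂ) * z ^ ν) := fun ν => by
    have : (((α - ν) * φ : ℝ) : ℂ) * Complex.I =
        (α * φ : ℝ) * Complex.I + ν * ((-φ : ℝ) * Complex.I) := by push_cast; ring
    rw [this, Complex.exp_add, Complex.exp_nat_mul, hz, neg_pow (Complex.exp _)]
    ring
  simp_rw [h]
  rw [tsum_mul_left, norm_mul, Complex.norm_exp_ofReal_mul_I, one_mul, norm_tsum_fracBinom hα hz1,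
    hz, ← sub_eq_add_neg, norm_sub_rev, mul_comm, Complex.norm_exp_I_mul_ofReal_sub_one]
  congr 1
  rw [Real.norm_eq_abs, neg_div, Real.sin_neg, mul_neg, abs_neg]

end Symbol

theorem fact_two_pi_pos : Fact (0 < 2 * π) := ⟨two_pi_pos⟩

section Transfer

open AddCircle

attribute [local instance] fact_two_pi_pos

/-- A function of two real variables which is `2π`-periodic in each of them. -/
structure IsBiperiodic (f : ℝ → ℝ → ℝ) : Prop where
  left : ∀ y, Function.Periodic (fun x => f x y) (2 * π)
  right : ∀ x, Function.Periodic (f x) (2 * π)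

theorem IsBiperiodic.diffX {f : ℝ → ℝ → ℝ} (hf : IsBiperiodic f) (α h : ℝ) :
    IsBiperiodic (diffX α h f) where
  left y x := tsum_congr fun ν => by
    rw [add_right_comm]; exact congrArg _ (hf.left y _)
  right x y := tsum_congr fun ν => by rw [hf.right]

theorem IsBiperiodic.diffY {f : ℝ → ℝ → ℝ} (hf : IsBiperiodic f) (α h : ℝ) :
    IsBiperiodic (diffY α h f) where
  left y x := tsum_congr fun ν => by
    exact congrArg _ (hf.left _ x)
  right x y := tsum_congr fun ν => by rw [add_right_comm, hf.right x]

/-- The function on the torus induced by a periodic function of two real variables. -/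
def torusLift (f : ℝ → ℝ → ℝ) (z : AddCircle (2 * π) × AddCircle (2 * π)) : ℂ :=
  (f (equivIoc (2 * π) 0 z.1) (equivIoc (2 * π) 0 z.2) : ℂ)

theorem apply_equivIoc_coe {g : ℝ → ℝ} (hg : Function.Periodic g (2 * π)) (x : ℝ) :
    g (equivIoc (2 * π) 0 (x : AddCircle (2 * π))) = g x := by
  have h : ((equivIoc (2 * π) 0 (x : AddCircle (2 * π)) : ℝ) : AddCircle (2 * π)) = x :=
    coe_equivIoc
  rw [← hg.lift_coe, h, hg.lift_coe]

/-- The quotient map from the plane to the torus. -/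
def torusMk (x y : ℝ) : AddCircle (2 * π) × AddCircle (2 * π) := (x, y)

theorem torusMk_add (x y x' y' : ℝ) :
    torusMk x y + torusMk x' y' = torusMk (x + x') (y + y') := by
  simp only [torusMk, Prod.mk_add_mk, AddCircle.coe_add]

theorem exists_eq_torusMk (z : AddCircle (2 * π) × AddCircle (2 * π)) :
    ∃ x y, z = torusMk x y := by
  obtain ⟨a, b⟩ := z
  induction a using QuotientAddGroup.induction_on with | _ x
  induction b using QuotientAddGroup.induction_on with | _ y
  exact ⟨x, y, rfl⟩

theorem torusLift_mk {f : ℝ → ℝ → ℝ} (hf : IsBiperiodic f) (x y : ℝ) :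
    torusLift f (torusMk x y) = f x y := by
  rw [torusLift, torusMk, apply_equivIoc_coe (hf.left _), apply_equivIoc_coe (hf.right x)]

theorem measurable_torusLift {f : ℝ → ℝ → ℝ} (hf : Measurable (Function.uncurry f)) :
    Measurable (torusLift f) := by
  have h : Measurable fun a : AddCircle (2 * π) => (equivIoc (2 * π) 0 a : ℝ) :=
    measurable_subtype_coe.comp (measurableEquivIoc (2 * π) 0).measurable
  exact Complex.measurable_ofReal.comp
    (hf.comp ((h.comp measurable_fst).prodMk (h.comp measurable_snd)))

theorem lintegral_Ioc_coe (g : AddCircle (2 * π) → ℝ≥0∞) :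
    ∫⁻ x in Set.Ioc 0 (2 * π), g x = ENNReal.ofReal (2 * π) * ∫⁻ a, g a ∂haarAddCircle := by
  have := AddCircle.lintegral_preimage (2 * π) 0 g
  rw [zero_add, volume_eq_smul_haarAddCircle, lintegral_smul_measure, smul_eq_mul] at this
  exact this

theorem Lp2Norm_eq {f : ℝ → ℝ → ℝ} (hf : IsBiperiodic f) {p : ℝ} (hp : 0 < p)
    (hm : AEStronglyMeasurable (torusLift f) (haarAddCircle.prod haarAddCircle)) :
    Lp2Norm p f = ENNReal.ofReal ((2 * π) ^ (2 / p)) *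
      eLpNorm' (torusLift f) p (haarAddCircle.prod haarAddCircle) := by
  have h : ∀ x y, ENNReal.ofReal (|f x y| ^ p) = ‖torusLift f (x, y)‖ₑ ^ p := fun x y => by
    rw [show torusLift f (x, y) = f x y from torusLift_mk hf x y, ← ofReal_norm, Complex.norm_real,
      ENNReal.ofReal_rpow_of_nonneg (norm_nonneg _) hp.le, Real.norm_eq_abs]
  have hp' : 0 ≤ 1 / p := by positivity
  rw [Lp2Norm, eLpNorm']
  simp_rw [h]
  have h1 : ∀ a, ∫⁻ y in Set.Ioc 0 (2 * π), ‖torusLift f (a, (y : AddCircle (2 * π)))‖ₑ ^ p =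
      ENNReal.ofReal (2 * π) * ∫⁻ b, ‖torusLift f (a, b)‖ₑ ^ p ∂haarAddCircle := fun a =>
    lintegral_Ioc_coe fun b => ‖torusLift f (a, b)‖ₑ ^ p
  simp_rw [h1]
  rw [lintegral_const_mul' _ _ ENNReal.ofReal_ne_top,
    lintegral_Ioc_coe fun a => ∫⁻ b, ‖torusLift f (a, b)‖ₑ ^ p ∂haarAddCircle,
    ← lintegral_prod (fun z => ‖torusLift f z‖ₑ ^ p) (hm.enorm.pow_const p), ← mul_assoc,
    ← ENNReal.ofReal_mul two_pi_pos.le, ENNReal.mul_rpow_of_nonneg _ _ hp',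
    ENNReal.ofReal_rpow_of_nonneg (by positivity) hp', ← sq, ← Real.rpow_natCast,
    ← Real.rpow_mul two_pi_pos.le]
  congr 3
  push_cast
  ring

theorem MemLp0.isBiperiodic {p : ℝ} {f : ℝ → ℝ → ℝ} (hf : MemLp0 p f) : IsBiperiodic f :=
  ⟨hf.periodic_x, hf.periodic_y⟩

theorem MemLp0.integrable_torusLift {p : ℝ} {f : ℝ → ℝ → ℝ} (hp : 1 < p) (hf : MemLp0 p f) :
    Integrable (torusLift f) (haarAddCircle.prod haarAddCircle) := by
  have hp0 : 0 < p := by linarith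
  have hm := (measurable_torusLift hf.meas).aestronglyMeasurable
    (μ := haarAddCircle.prod haarAddCircle)
  have h := hf.norm_ne_top
  rw [Lp2Norm_eq hf.isBiperiodic hp0 hm] at h
  have h' : eLpNorm' (torusLift f) p (haarAddCircle.prod haarAddCircle) < ⊤ := by
    refine lt_top_iff_ne_top.2 fun h0 => h ?_
    rw [h0, ENNReal.mul_top]
    simp only [ne_eq, ENNReal.ofReal_eq_zero, not_le]
    positivity
  have : MemLp (torusLift f) (ENNReal.ofReal p) (haarAddCircle.prod haarAddCircle) := by
    refine ⟨hm, ?_⟩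
    rwa [eLpNorm_eq_eLpNorm' (by simpa using hp0) ENNReal.ofReal_ne_top,
      ENNReal.toReal_ofReal hp0.le]
  exact this.integrable (by simpa using hp.le)

theorem torusLift_diffX {f : ℝ → ℝ → ℝ} (hf : IsBiperiodic f) (α h : ℝ) :
    torusLift (diffX α h f) = fun t => ∑' ν : ℕ, ((-1) ^ ν * fracBinom α ν : ℂ) *
      torusLift f (t + torusMk ((α - ν) * h) 0) := by
  ext z
  obtain ⟨x, y, rfl⟩ := exists_eq_torusMk z
  rw [torusLift_mk (hf.diffX α h), diffX, Complex.ofReal_tsum]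
  refine tsum_congr fun ν => ?_
  rw [torusMk_add, add_zero, torusLift_mk hf]
  push_cast
  ring

theorem torusLift_diffY {f : ℝ → ℝ → ℝ} (hf : IsBiperiodic f) (α h : ℝ) :
    torusLift (diffY α h f) = fun t => ∑' ν : ℕ, ((-1) ^ ν * fracBinom α ν : ℂ) *
      torusLift f (t + torusMk 0 ((α - ν) * h)) := by
  ext z
  obtain ⟨x, y, rfl⟩ := exists_eq_torusMk z
  rw [torusLift_mk (hf.diffY α h), diffY, Complex.ofReal_tsum]
  refine tsum_congr fun ν => ?_
  rw [torusMk_add, add_zero, torusLift_mk hf]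
  push_cast
  ring

theorem summable_norm_neg_one_pow_mul_fracBinom {α : ℝ} (hα : 0 < α) :
    Summable fun ν : ℕ => ‖((-1) ^ ν * fracBinom α ν : ℂ)‖ := by
  simpa using summable_abs_fracBinom hα

theorem integrable_torusLift_diffX {f : ℝ → ℝ → ℝ} (hf : IsBiperiodic f)
    (hi : Integrable (torusLift f) (haarAddCircle.prod haarAddCircle)) {α : ℝ} (hα : 0 < α)
    (h : ℝ) : Integrable (torusLift (diffX α h f)) (haarAddCircle.prod haarAddCircle) := by
  rw [torusLift_diffX hf]
  exact integrable_shiftSeries (summable_norm_neg_one_pow_mul_fracBinom hα) _ hi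

theorem integrable_torusLift_diffY {f : ℝ → ℝ → ℝ} (hf : IsBiperiodic f)
    (hi : Integrable (torusLift f) (haarAddCircle.prod haarAddCircle)) {α : ℝ} (hα : 0 < α)
    (h : ℝ) : Integrable (torusLift (diffY α h f)) (haarAddCircle.prod haarAddCircle) := by
  rw [torusLift_diffY hf]
  exact integrable_shiftSeries (summable_norm_neg_one_pow_mul_fracBinom hα) _ hi

/-- The characters of the two-dimensional torus. -/
def torusChar (k l : ℤ) (z : AddCircle (2 * π) × AddCircle (2 * π)) : ℂ :=
  fourier (-k) z.1 * fourier (-l) z.2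

theorem continuous_torusChar (k l : ℤ) : Continuous (torusChar k l) := by
  unfold torusChar; fun_prop

theorem norm_torusChar (k l : ℤ) (z : AddCircle (2 * π) × AddCircle (2 * π)) :
    ‖torusChar k l z‖ = 1 := by
  rw [torusChar, norm_mul, fourier_apply, fourier_apply, Circle.norm_coe, Circle.norm_coe, one_mul]

theorem torusChar_add (k l : ℤ) (z w : AddCircle (2 * π) × AddCircle (2 * π)) :
    torusChar k l (z + w) = torusChar k l z * torusChar k l w := by
  simp only [torusChar, Prod.fst_add, Prod.snd_add, fourier_apply, smul_add, toCircle_add,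
    Circle.coe_mul]
  ring

theorem inv_torusChar_coe (k l : ℤ) (x y : ℝ) :
    (torusChar k l (torusMk x y))⁻¹ = Complex.exp ((k * x + l * y : ℝ) * Complex.I) := by
  rw [torusChar, torusMk, fourier_coe_apply, fourier_coe_apply, ← Complex.exp_add, ← Complex.exp_neg]
  congr 1
  have : (π : ℂ) ≠ 0 := by exact_mod_cast pi_ne_zero
  push_cast
  field_simp
  ring

theorem torusCoeff_eq_integral {u : AddCircle (2 * π) × AddCircle (2 * π) → ℂ}
    (hu : Integrable u (haarAddCircle.prod haarAddCircle)) (k l : ℤ) :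
    torusCoeff u k l = ∫ z, torusChar k l z * u z ∂(haarAddCircle.prod haarAddCircle) := by
  have : Integrable (fun z => torusChar k l z * u z) (haarAddCircle.prod haarAddCircle) :=
    hu.bdd_mul (c := 1) (continuous_torusChar k l).aestronglyMeasurable
      (ae_of_all _ fun z => (norm_torusChar k l z).le)
  rw [integral_prod _ this, torusCoeff, fourierCoeff]
  refine integral_congr_ae (ae_of_all _ fun a => ?_)
  simp only [fourierCoeff, torusChar, smul_eq_mul, mul_assoc]
  rw [integral_const_mul]

theorem norm_torusCoeff_diffX {f : ℝ → ℝ → ℝ} (hf : IsBiperiodic f)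
    (hi : Integrable (torusLift f) (haarAddCircle.prod haarAddCircle)) {α : ℝ} (hα : 0 < α)
    (h : ℝ) (k l : ℤ) : ‖torusCoeff (torusLift (diffX α h f)) k l‖ =
      |2 * Real.sin (k * h / 2)| ^ α * ‖torusCoeff (torusLift f) k l‖ := by
  rw [torusCoeff_eq_integral (integrable_torusLift_diffX hf hi hα h), torusCoeff_eq_integral hi,
    torusLift_diffX hf, integral_character_mul_shiftSeries
      (summable_norm_neg_one_pow_mul_fracBinom hα) _ hi
      (continuous_torusChar k l).aestronglyMeasurable (norm_torusChar k l) (torusChar_add k l),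
    norm_mul, ← norm_tsum_fracBinom_mul_exp hα]
  congr 2
  refine tsum_congr fun ν => ?_
  rw [inv_torusChar_coe]
  congr 4
  ring

theorem norm_torusCoeff_diffY {f : ℝ → ℝ → ℝ} (hf : IsBiperiodic f)
    (hi : Integrable (torusLift f) (haarAddCircle.prod haarAddCircle)) {α : ℝ} (hα : 0 < α)
    (h : ℝ) (k l : ℤ) : ‖torusCoeff (torusLift (diffY α h f)) k l‖ =
      |2 * Real.sin (l * h / 2)| ^ α * ‖torusCoeff (torusLift f) k l‖ := by
  rw [torusCoeff_eq_integral (integrable_torusLift_diffY hf hi hα h), torusCoeff_eq_integral hi,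
    torusLift_diffY hf, integral_character_mul_shiftSeries
      (summable_norm_neg_one_pow_mul_fracBinom hα) _ hi
      (continuous_torusChar k l).aestronglyMeasurable (norm_torusChar k l) (torusChar_add k l),
    norm_mul, ← norm_tsum_fracBinom_mul_exp hα]
  congr 2
  refine tsum_congr fun ν => ?_
  rw [inv_torusChar_coe]
  congr 4
  ring

end Transfer

section Coefficients

open AddCircle

attribute [local instance] fact_two_pi_pos

theorem intervalIntegral_coe (g : AddCircle (2 * π) → ℂ) :
    ∫ x in (0 : ℝ)..2 * π, g x = (2 * π : ℝ) * ∫ a, g a ∂haarAddCircle := by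
  have := AddCircle.intervalIntegral_preimage (2 * π) 0 g
  rw [zero_add] at this
  rw [this, integral_haarAddCircle, Complex.real_smul, ← mul_assoc, ← Complex.ofReal_mul,
    mul_inv_cancel₀ two_pi_pos.ne', Complex.ofReal_one, one_mul]

theorem intervalIntegral_torusMk {v : AddCircle (2 * π) × AddCircle (2 * π) → ℂ}
    (hv : Integrable v (haarAddCircle.prod haarAddCircle)) :
    ∫ x in (0 : ℝ)..2 * π, ∫ y in (0 : ℝ)..2 * π, v (torusMk x y) =
      (2 * π : ℝ) ^ 2 * ∫ z, v z ∂(haarAddCircle.prod haarAddCircle) := by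
  have h1 : ∀ x : ℝ, ∫ y in (0 : ℝ)..2 * π, v (torusMk x y) =
      (2 * π : ℝ) * ∫ b, v (x, b) ∂haarAddCircle := fun x => intervalIntegral_coe fun b => v (x, b)
  simp_rw [h1]
  rw [intervalIntegral.integral_const_mul,
    intervalIntegral_coe fun a => ∫ b, v (a, b) ∂haarAddCircle, integral_prod _ hv]
  ring

theorem intervalIntegral_torusMk_symm {v : AddCircle (2 * π) × AddCircle (2 * π) → ℂ}
    (hv : Integrable v (haarAddCircle.prod haarAddCircle)) :
    ∫ y in (0 : ℝ)..2 * π, ∫ x in (0 : ℝ)..2 * π, v (torusMk x y) =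
      (2 * π : ℝ) ^ 2 * ∫ z, v z ∂(haarAddCircle.prod haarAddCircle) := by
  have h1 : ∀ y : ℝ, ∫ x in (0 : ℝ)..2 * π, v (torusMk x y) =
      (2 * π : ℝ) * ∫ a, v (a, y) ∂haarAddCircle := fun y => intervalIntegral_coe fun a => v (a, y)
  simp_rw [h1]
  rw [intervalIntegral.integral_const_mul,
    intervalIntegral_coe fun b => ∫ a, v (a, b) ∂haarAddCircle, integral_prod_symm _ hv]
  ring

theorem integrable_torusChar_mul {u : AddCircle (2 * π) × AddCircle (2 * π) → ℂ}
    (hu : Integrable u (haarAddCircle.prod haarAddCircle)) (k l : ℤ) :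
    Integrable (fun z => torusChar k l z * u z) (haarAddCircle.prod haarAddCircle) :=
  hu.bdd_mul (c := 1) (continuous_torusChar k l).aestronglyMeasurable
    (ae_of_all _ fun z => (norm_torusChar k l z).le)

theorem torusChar_torusMk (k l : ℤ) (x y : ℝ) :
    torusChar k l (torusMk x y) =
      Complex.exp (-(k * x * Complex.I)) * Complex.exp (-(l * y * Complex.I)) := by
  rw [← inv_inv (torusChar k l (torusMk x y)), inv_torusChar_coe, ← Complex.exp_neg,
    ← Complex.exp_add]
  congr 1
  push_cast
  ring

variable {p : ℝ} {f : ℝ → ℝ → ℝ}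

theorem torusCoeff_zero_left (hp : 1 < p) (hf : MemLp0 p f) (l : ℤ) :
    torusCoeff (torusLift f) 0 l = 0 := by
  have hi := hf.integrable_torusLift hp
  have h := intervalIntegral_torusMk_symm (integrable_torusChar_mul hi 0 l)
  rw [← torusCoeff_eq_integral hi] at h
  have h0 : ∫ y in (0 : ℝ)..2 * π, ∫ x in (0 : ℝ)..2 * π,
      torusChar 0 l (torusMk x y) * torusLift f (torusMk x y) = 0 := by
    refine intervalIntegral.integral_zero_ae ?_
    filter_upwards [hf.mean_x] with y hy _
    simp_rw [torusChar_torusMk, torusLift_mk hf.isBiperiodic]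
    simp only [Int.cast_zero, zero_mul, neg_zero, Complex.exp_zero, one_mul]
    rw [intervalIntegral.integral_const_mul, intervalIntegral.integral_ofReal, hy]
    simp
  rw [h0] at h
  have : ((2 * π : ℝ) : ℂ) ^ 2 ≠ 0 := by
    exact_mod_cast (pow_pos two_pi_pos 2).ne'
  exact (mul_eq_zero.1 h.symm).resolve_left this

theorem torusCoeff_zero_right (hp : 1 < p) (hf : MemLp0 p f) (k : ℤ) :
    torusCoeff (torusLift f) k 0 = 0 := by
  have hi := hf.integrable_torusLift hp
  have h := intervalIntegral_torusMk (integrable_torusChar_mul hi k 0)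
  rw [← torusCoeff_eq_integral hi] at h
  have h0 : ∫ x in (0 : ℝ)..2 * π, ∫ y in (0 : ℝ)..2 * π,
      torusChar k 0 (torusMk x y) * torusLift f (torusMk x y) = 0 := by
    refine intervalIntegral.integral_zero_ae ?_
    filter_upwards [hf.mean_y] with x hx _
    simp_rw [torusChar_torusMk, torusLift_mk hf.isBiperiodic]
    simp only [Int.cast_zero, zero_mul, neg_zero, Complex.exp_zero, mul_one]
    rw [intervalIntegral.integral_const_mul, intervalIntegral.integral_ofReal, hx]
    simp
  rw [h0] at h
  have : ((2 * π : ℝ) : ℂ) ^ 2 ≠ 0 := by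
    exact_mod_cast (pow_pos two_pi_pos 2).ne'
  exact (mul_eq_zero.1 h.symm).resolve_left this

/-- A real trigonometric coefficient is the matching combination of the complex ones. -/
theorem ofReal_trig_integral (hf : IsBiperiodic f)
    (hi : Integrable (torusLift f) (haarAddCircle.prod haarAddCircle)) {m n : ℤ}
    {c₁ c₂ c₃ c₄ : ℂ} {g : ℝ → ℝ → ℝ}
    (hg : ∀ x y, (g x y : ℂ) = f x y * (c₁ * torusChar m n (torusMk x y) +
      c₂ * torusChar (-m) n (torusMk x y) + c₃ * torusChar m (-n) (torusMk x y) +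
      c₄ * torusChar (-m) (-n) (torusMk x y)) / 4) :
    ((1 / π ^ 2 * ∫ x in (0 : ℝ)..2 * π, ∫ y in (0 : ℝ)..2 * π, g x y : ℝ) : ℂ) =
      c₁ * torusCoeff (torusLift f) m n + c₂ * torusCoeff (torusLift f) (-m) n +
      c₃ * torusCoeff (torusLift f) m (-n) + c₄ * torusCoeff (torusLift f) (-m) (-n) := by
  have hI := fun k l c => (integrable_torusChar_mul hi k l).const_mul c
  have h12 := (hI m n c₁).add (hI (-m) n c₂)
  have h123 := h12.add (hI m (-n) c₃)
  have h1234 := (h123.add (hI (-m) (-n) c₄)).div_const 4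
  have hg' : ∫ x in (0 : ℝ)..2 * π, ∫ y in (0 : ℝ)..2 * π, (g x y : ℂ) = _ :=
    (intervalIntegral.integral_congr fun x _ => intervalIntegral.integral_congr fun y _ => by
      simp only [Pi.add_apply]
      rw [hg, torusLift_mk hf]
      ring).trans (intervalIntegral_torusMk h1234)
  rw [integral_div, integral_add' h123 (hI (-m) (-n) c₄), integral_add' h12 (hI m (-n) c₃),
    integral_add' (hI m n c₁) (hI (-m) n c₂)] at hg'
  simp only [integral_const_mul, ← torusCoeff_eq_integral hi] at hg'
  have hπ : (π : ℂ) ≠ 0 := by exact_mod_cast pi_ne_zero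
  rw [Complex.ofReal_mul, ← intervalIntegral.integral_ofReal]
  simp_rw [← intervalIntegral.integral_ofReal]
  rw [hg']
  push_cast
  field_simp
  ring

theorem ofReal_cos_eq (x : ℝ) : (Real.cos x : ℂ) =
    (Complex.exp (x * Complex.I) + Complex.exp (-(x * Complex.I))) / 2 := by
  rw [Complex.ofReal_cos, Complex.cos, neg_mul]

theorem ofReal_sin_eq (x : ℝ) : (Real.sin x : ℂ) =
    (Complex.exp (-(x * Complex.I)) - Complex.exp (x * Complex.I)) * Complex.I / 2 := by
  rw [Complex.ofReal_sin, Complex.sin, neg_mul]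

theorem ofReal_fourierCC (hf : IsBiperiodic f)
    (hi : Integrable (torusLift f) (haarAddCircle.prod haarAddCircle)) (m n : ℕ) :
    (fourierCC f m n : ℂ) =
      1 * torusCoeff (torusLift f) m n + 1 * torusCoeff (torusLift f) (-m) n +
      1 * torusCoeff (torusLift f) m (-n) + 1 * torusCoeff (torusLift f) (-m) (-n) := by
  refine ofReal_trig_integral hf hi fun x y => ?_
  simp only [Complex.ofReal_mul, torusChar_torusMk, ofReal_cos_eq]
  push_cast
  simp only [neg_mul, neg_neg]
  ring

theorem ofReal_fourierSC (hf : IsBiperiodic f)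
    (hi : Integrable (torusLift f) (haarAddCircle.prod haarAddCircle)) (m n : ℕ) :
    (fourierSC f m n : ℂ) =
      Complex.I * torusCoeff (torusLift f) m n + (-Complex.I) * torusCoeff (torusLift f) (-m) n +
      Complex.I * torusCoeff (torusLift f) m (-n) + (-Complex.I) * torusCoeff (torusLift f) (-m) (-n) := by
  refine ofReal_trig_integral hf hi fun x y => ?_
  simp only [Complex.ofReal_mul, torusChar_torusMk, ofReal_cos_eq, ofReal_sin_eq]
  push_cast
  simp only [neg_mul, neg_neg]
  ring

theorem ofReal_fourierCS (hf : IsBiperiodic f)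
    (hi : Integrable (torusLift f) (haarAddCircle.prod haarAddCircle)) (m n : ℕ) :
    (fourierCS f m n : ℂ) =
      Complex.I * torusCoeff (torusLift f) m n + Complex.I * torusCoeff (torusLift f) (-m) n +
      (-Complex.I) * torusCoeff (torusLift f) m (-n) + (-Complex.I) * torusCoeff (torusLift f) (-m) (-n) := by
  refine ofReal_trig_integral hf hi fun x y => ?_
  simp only [Complex.ofReal_mul, torusChar_torusMk, ofReal_cos_eq, ofReal_sin_eq]
  push_cast
  simp only [neg_mul, neg_neg]
  ring

theorem ofReal_fourierSS (hf : IsBiperiodic f)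
    (hi : Integrable (torusLift f) (haarAddCircle.prod haarAddCircle)) (m n : ℕ) :
    (fourierSS f m n : ℂ) =
      (-1) * torusCoeff (torusLift f) m n + 1 * torusCoeff (torusLift f) (-m) n +
      1 * torusCoeff (torusLift f) m (-n) + (-1) * torusCoeff (torusLift f) (-m) (-n) := by
  refine ofReal_trig_integral hf hi fun x y => ?_
  simp only [Complex.ofReal_mul, torusChar_torusMk, ofReal_sin_eq]
  push_cast
  simp only [neg_mul, neg_neg]
  ring_nf
  simp only [Complex.I_sq]
  ring

theorem rhoCoef_nonneg (f : ℝ → ℝ → ℝ) (m n : ℕ) : 0 ≤ rhoCoef f m n := by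
  unfold rhoCoef; positivity

theorem rhoCoef_le (hf : IsBiperiodic f)
    (hi : Integrable (torusLift f) (haarAddCircle.prod haarAddCircle)) (m n : ℕ) :
    rhoCoef f m n ≤ 4 * (‖torusCoeff (torusLift f) m n‖ + ‖torusCoeff (torusLift f) (-m) n‖ +
      ‖torusCoeff (torusLift f) m (-n)‖ + ‖torusCoeff (torusLift f) (-m) (-n)‖) := by
  have key : ∀ (r : ℝ) (c₁ c₂ c₃ c₄ z₁ z₂ z₃ z₄ : ℂ), ‖c₁‖ = 1 → ‖c₂‖ = 1 → ‖c₃‖ = 1 → ‖c₄‖ = 1 →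
      (r : ℂ) = c₁ * z₁ + c₂ * z₂ + c₃ * z₃ + c₄ * z₄ → |r| ≤ ‖z₁‖ + ‖z₂‖ + ‖z₃‖ + ‖z₄‖ := by
    intro r c₁ c₂ c₃ c₄ z₁ z₂ z₃ z₄ h₁ h₂ h₃ h₄ h
    rw [← Real.norm_eq_abs, ← Complex.norm_real, h]
    refine norm_add₄_le.trans_eq ?_
    simp only [norm_mul, h₁, h₂, h₃, h₄, one_mul]
  have h1 := key _ _ _ _ _ _ _ _ _ (by simp) (by simp) (by simp) (by simp)
    (ofReal_fourierCC hf hi m n)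
  have h2 := key _ _ _ _ _ _ _ _ _ (by simp) (by simp) (by simp) (by simp)
    (ofReal_fourierSC hf hi m n)
  have h3 := key _ _ _ _ _ _ _ _ _ (by simp) (by simp) (by simp) (by simp)
    (ofReal_fourierCS hf hi m n)
  have h4 := key _ _ _ _ _ _ _ _ _ (by simp) (by simp) (by simp) (by simp)
    (ofReal_fourierSS hf hi m n)
  unfold rhoCoef
  linarith

theorem norm_torusCoeff_le_rhoCoef (hf : IsBiperiodic f)
    (hi : Integrable (torusLift f) (haarAddCircle.prod haarAddCircle)) (k l : ℤ) :
    ‖torusCoeff (torusLift f) k l‖ ≤ rhoCoef f k.natAbs l.natAbs := by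
  have key : ∀ (r₁ r₂ r₃ r₄ : ℝ) (c₁ c₂ c₃ z : ℂ), ‖c₁‖ = 1 → ‖c₂‖ = 1 → ‖c₃‖ = 1 →
      4 * z = r₁ + c₁ * r₂ + c₂ * r₃ + c₃ * r₄ → ‖z‖ ≤ |r₁| + |r₂| + |r₃| + |r₄| := by
    intro r₁ r₂ r₃ r₄ c₁ c₂ c₃ z h₁ h₂ h₃ h
    have h' : 4 * ‖z‖ ≤ |r₁| + |r₂| + |r₃| + |r₄| := by
      have : 4 * ‖z‖ = ‖4 * z‖ := by rw [norm_mul]; simp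
      rw [this, h]
      refine norm_add₄_le.trans_eq ?_
      simp only [norm_mul, h₁, h₂, h₃, one_mul, Complex.norm_real, Real.norm_eq_abs]
    have := norm_nonneg z
    linarith
  have h1 := ofReal_fourierCC hf hi k.natAbs l.natAbs
  have h2 := ofReal_fourierSC hf hi k.natAbs l.natAbs
  have h3 := ofReal_fourierCS hf hi k.natAbs l.natAbs
  have h4 := ofReal_fourierSS hf hi k.natAbs l.natAbs
  unfold rhoCoef
  generalize torusCoeff (torusLift f) = c at *
  have hI : Complex.I * Complex.I = -1 := Complex.I_mul_I
  rcases Int.natAbs_eq k with hk | hk <;> rcases Int.natAbs_eq l with hl | hl <;>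
    rw [hk, hl] <;> simp only [Int.natAbs_neg, Int.natAbs_natCast]
  · refine key _ _ _ _ (-Complex.I) (-Complex.I) (-1) _ (by simp) (by simp) (by simp) ?_
    rw [h1, h2, h3, h4]; ring_nf; simp only [Complex.I_sq]; ring
  · refine key _ _ _ _ (-Complex.I) Complex.I 1 _ (by simp) (by simp) (by simp) ?_
    rw [h1, h2, h3, h4]; ring_nf; simp only [Complex.I_sq]; ring
  · refine key _ _ _ _ Complex.I (-Complex.I) 1 _ (by simp) (by simp) (by simp) ?_
    rw [h1, h2, h3, h4]; ring_nf; simp only [Complex.I_sq]; ring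
  · refine key _ _ _ _ Complex.I Complex.I (-1) _ (by simp) (by simp) (by simp) ?_
    rw [h1, h2, h3, h4]; ring_nf; simp only [Complex.I_sq]; ring

end Coefficients

section Cutoff

theorem tsum_nat_succ_eq_sum_Icc_add_tsum (F : ℕ → ℝ≥0∞) (n : ℕ) :
    ∑' i, F (i + 1) = ∑ ν ∈ Finset.Icc 1 n, F ν + ∑' k, F (n + 1 + k) := by
  have h : ∑ i ∈ Finset.range n, F (i + 1) + ∑' i, F (i + n + 1) = ∑' i, F (i + 1) :=
    Summable.sum_add_tsum_nat_add' (f := fun i => F (i + 1)) ENNReal.summable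
  rw [← h]
  congr 1
  · rw [← Finset.Ico_add_one_right_eq_Icc, Finset.sum_Ico_eq_sum_range, Nat.add_sub_cancel]
    exact Finset.sum_congr rfl fun i _ => congrArg F (add_comm _ _)
  · exact tsum_congr fun k => congrArg F (by ring)

/-- The weight which compares `|2 sin (k h / 2)|`, for `0 < h ≤ 1/n`, with a power of `k`. -/
def cutoffWeight (s α : ℝ) (n k : ℕ) : ℝ := (k : ℝ) ^ (s - 2) * min 1 ((k : ℝ) / n) ^ (α * s)

theorem cutoffWeight_nonneg (s α : ℝ) (n k : ℕ) : 0 ≤ cutoffWeight s α n k := by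
  unfold cutoffWeight; positivity

theorem cutoffWeight_of_le {s α : ℝ} {n k : ℕ} (hk : 1 ≤ k) (hkn : k ≤ n) :
    cutoffWeight s α n k = ((n : ℝ) ^ (-α)) ^ s * (k : ℝ) ^ ((α + 1) * s - 2) := by
  have hk0 : (0 : ℝ) < k := by exact_mod_cast hk
  have hn0 : (0 : ℝ) < n := by exact_mod_cast hk.trans hkn
  have h1 : (k : ℝ) / n ≤ 1 := by rw [div_le_one hn0]; exact_mod_cast hkn
  rw [cutoffWeight, min_eq_right h1, Real.div_rpow hk0.le hn0.le, ← Real.rpow_mul hn0.le,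
    neg_mul, Real.rpow_neg hn0.le, div_eq_mul_inv, ← mul_assoc, ← Real.rpow_add hk0, mul_comm]
  congr 2
  ring

theorem cutoffWeight_of_ge {s α : ℝ} {n k : ℕ} (hn : 1 ≤ n) (hkn : n ≤ k) :
    cutoffWeight s α n k = (k : ℝ) ^ (s - 2) := by
  have hn0 : (0 : ℝ) < n := by exact_mod_cast hn
  have h1 : 1 ≤ (k : ℝ) / n := by rw [one_le_div hn0]; exact_mod_cast hkn
  rw [cutoffWeight, min_eq_left h1, Real.one_rpow, mul_one]

/-- One term of the weighted sum equivalent to the quantity `Ifun`. -/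
def cutoffTerm (f : ℝ → ℝ → ℝ) (α₁ α₂ : ℝ) (n₁ n₂ : ℕ) (s : ℝ) (k l : ℕ) : ℝ≥0∞ :=
  ENNReal.ofReal (cutoffWeight s α₁ n₁ k * cutoffWeight s α₂ n₂ l * rhoCoef f k l ^ s)

/-- A single weighted sum equivalent to the quantity `Ifun`. -/
def cutoffSum (f : ℝ → ℝ → ℝ) (α₁ α₂ : ℝ) (n₁ n₂ : ℕ) (s : ℝ) : ℝ≥0∞ :=
  ∑' (i : ℕ) (j : ℕ), cutoffTerm f α₁ α₂ n₁ n₂ s (i + 1) (j + 1)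

variable {f : ℝ → ℝ → ℝ} {α₁ α₂ s : ℝ} {n₁ n₂ : ℕ}

theorem cutoffSum_eq : cutoffSum f α₁ α₂ n₁ n₂ s =
    (∑ ν₁ ∈ Finset.Icc 1 n₁, ∑ ν₂ ∈ Finset.Icc 1 n₂, cutoffTerm f α₁ α₂ n₁ n₂ s ν₁ ν₂ +
      ∑ ν₁ ∈ Finset.Icc 1 n₁, ∑' k : ℕ, cutoffTerm f α₁ α₂ n₁ n₂ s ν₁ (n₂ + 1 + k)) +
    (∑ ν₂ ∈ Finset.Icc 1 n₂, ∑' k : ℕ, cutoffTerm f α₁ α₂ n₁ n₂ s (n₁ + 1 + k) ν₂ +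
      ∑' (j : ℕ) (k : ℕ), cutoffTerm f α₁ α₂ n₁ n₂ s (n₁ + 1 + j) (n₂ + 1 + k)) := by
  rw [cutoffSum]
  simp_rw [fun i => tsum_nat_succ_eq_sum_Icc_add_tsum
    (fun j => cutoffTerm f α₁ α₂ n₁ n₂ s (i + 1) j) n₂]
  rw [tsum_nat_succ_eq_sum_Icc_add_tsum (fun i => ∑ ν₂ ∈ Finset.Icc 1 n₂,
    cutoffTerm f α₁ α₂ n₁ n₂ s i ν₂ + ∑' k : ℕ, cutoffTerm f α₁ α₂ n₁ n₂ s i (n₂ + 1 + k)) n₁,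
    Finset.sum_add_distrib, ENNReal.tsum_add, Summable.tsum_finsetSum fun _ _ => ENNReal.summable]

theorem ofReal_mul_rpow_one_div {a : ℝ} (ha : 0 ≤ a) (hs : 0 < s) (S : ℝ≥0∞) :
    ENNReal.ofReal a * S ^ (1 / s) = (ENNReal.ofReal (a ^ s) * S) ^ (1 / s) := by
  rw [ENNReal.mul_rpow_of_nonneg _ _ (by positivity),
    ENNReal.ofReal_rpow_of_nonneg (by positivity) (by positivity), ← Real.rpow_mul ha,
    mul_one_div_cancel hs.ne', Real.rpow_one]

theorem Ifun_eq (hs : 0 < s) (hn₁ : 1 ≤ n₁) (hn₂ : 1 ≤ n₂) : Ifun f α₁ α₂ n₁ n₂ s =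
    (∑ ν₁ ∈ Finset.Icc 1 n₁, ∑ ν₂ ∈ Finset.Icc 1 n₂, cutoffTerm f α₁ α₂ n₁ n₂ s ν₁ ν₂) ^ (1 / s) +
    (∑ ν₁ ∈ Finset.Icc 1 n₁, ∑' k : ℕ, cutoffTerm f α₁ α₂ n₁ n₂ s ν₁ (n₂ + 1 + k)) ^ (1 / s) +
    (∑ ν₂ ∈ Finset.Icc 1 n₂, ∑' k : ℕ, cutoffTerm f α₁ α₂ n₁ n₂ s (n₁ + 1 + k) ν₂) ^ (1 / s) +
    (∑' (j : ℕ) (k : ℕ), cutoffTerm f α₁ α₂ n₁ n₂ s (n₁ + 1 + j) (n₂ + 1 + k)) ^ (1 / s) := by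
  rw [Ifun, ofReal_mul_rpow_one_div (by positivity) hs, ofReal_mul_rpow_one_div (by positivity) hs,
    ofReal_mul_rpow_one_div (by positivity) hs]
  simp only [Finset.mul_sum, ← ENNReal.tsum_mul_left]
  congr 1
  · congr 1
    · congr 1
      · congr 1
        refine Finset.sum_congr rfl fun ν₁ h₁ => Finset.sum_congr rfl fun ν₂ h₂ => ?_
        rw [Finset.mem_Icc] at h₁ h₂
        rw [cutoffTerm, cutoffWeight_of_le h₁.1 h₁.2, cutoffWeight_of_le h₂.1 h₂.2,
          ← ENNReal.ofReal_mul (by positivity), Real.mul_rpow (by positivity) (by positivity)]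
        congr 1
        ring
      · congr 1
        refine Finset.sum_congr rfl fun ν₁ h₁ => tsum_congr fun k => ?_
        rw [Finset.mem_Icc] at h₁
        rw [cutoffTerm, cutoffWeight_of_le h₁.1 h₁.2, cutoffWeight_of_ge hn₂ (by omega),
          ← ENNReal.ofReal_mul (by positivity)]
        congr 1
        ring
    · congr 1
      refine Finset.sum_congr rfl fun ν₂ h₂ => tsum_congr fun k => ?_
      rw [Finset.mem_Icc] at h₂
      rw [cutoffTerm, cutoffWeight_of_le h₂.1 h₂.2, cutoffWeight_of_ge hn₁ (by omega),
        ← ENNReal.ofReal_mul (by positivity)]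
      congr 1
      ring
  · congr 1
    refine tsum_congr fun j => tsum_congr fun k => ?_
    rw [cutoffTerm, cutoffWeight_of_ge hn₁ (by omega), cutoffWeight_of_ge hn₂ (by omega)]
    congr 1
    ring

theorem Ifun_le_cutoffSum (hs : 0 < s) (hn₁ : 1 ≤ n₁) (hn₂ : 1 ≤ n₂) :
    Ifun f α₁ α₂ n₁ n₂ s ≤ 4 * cutoffSum f α₁ α₂ n₁ n₂ s ^ (1 / s) := by
  have h4 : ∀ a : ℝ≥0∞, 4 * a = a + a + a + a := fun a => by ring
  have hs' : 0 ≤ 1 / s := by positivity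
  rw [Ifun_eq hs hn₁ hn₂, h4, cutoffSum_eq]
  gcongr
  · exact le_add_right le_self_add
  · exact le_add_right le_add_self
  · exact le_add_left le_self_add
  · exact le_add_left le_add_self

theorem cutoffSum_le_Ifun (hs : 1 ≤ s) (hn₁ : 1 ≤ n₁) (hn₂ : 1 ≤ n₂) :
    cutoffSum f α₁ α₂ n₁ n₂ s ^ (1 / s) ≤ Ifun f α₁ α₂ n₁ n₂ s := by
  have hs0 : 0 ≤ 1 / s := by positivity
  have hs1 : 1 / s ≤ 1 := by rw [div_le_one (by linarith)]; exact hs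
  rw [Ifun_eq (by linarith) hn₁ hn₂, cutoffSum_eq, add_assoc (_ + _)]
  refine (ENNReal.rpow_add_le_add_rpow _ _ hs0 hs1).trans ?_
  gcongr
  · exact ENNReal.rpow_add_le_add_rpow _ _ hs0 hs1
  · exact ENNReal.rpow_add_le_add_rpow _ _ hs0 hs1

end Cutoff

section SineAverage

theorem continuous_abs_two_mul_sin_rpow {β : ℝ} (hβ : 0 < β) (k : ℝ) :
    Continuous fun h : ℝ => |2 * Real.sin (k * h / 2)| ^ β :=
  (by fun_prop : Continuous fun h : ℝ => |2 * Real.sin (k * h / 2)|).rpow_const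
    fun _ => Or.inr hβ.le

theorem intervalIntegral_sq_two_mul_sin {k : ℝ} (hk : k ≠ 0) (b : ℝ) :
    ∫ h in (0 : ℝ)..b, (2 * Real.sin (k * h / 2)) ^ 2 = 2 * b - 2 * Real.sin (k * b) / k := by
  have h1 : ∀ h ∈ Set.uIcc 0 b, HasDerivAt (fun h => 2 * h - 2 * Real.sin (k * h) / k)
      ((2 * Real.sin (k * h / 2)) ^ 2) h := by
    intro h _
    have h2 : HasDerivAt (fun h => Real.sin (k * h)) (Real.cos (k * h) * (k * 1)) h :=
      ((hasDerivAt_id h).const_mul k).sin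
    have h3 := ((hasDerivAt_id h).const_mul 2).sub ((h2.const_mul 2).div_const k)
    refine h3.congr_deriv ?_
    have h4 : Real.cos (k * h) = 1 - 2 * Real.sin (k * h / 2) ^ 2 := by
      have := Real.cos_two_mul (k * h / 2)
      rw [mul_div_cancel₀ _ two_ne_zero] at this
      rw [this, Real.cos_sq']
      ring
    rw [h4]
    field_simp
    ring
  rw [intervalIntegral.integral_eq_sub_of_hasDerivAt h1
    (Continuous.intervalIntegrable (by fun_prop) _ _)]
  simp

theorem rpow_ge_of_le_two {β t : ℝ} (hβ : 0 < β) (ht : 0 ≤ t) (ht2 : t ≤ 2) :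
    (1 / 2) ^ β * ((t ^ 2 - 1 / 4) / 4) ≤ t ^ β := by
  have hδ : 0 ≤ (1 / 2 : ℝ) ^ β := by positivity
  have htβ : 0 ≤ t ^ β := by positivity
  rcases le_total t (1 / 2) with h | h
  · have : (t ^ 2 - 1 / 4) / 4 ≤ 0 := by nlinarith
    nlinarith
  · have h1 : (1 / 2 : ℝ) ^ β ≤ t ^ β := Real.rpow_le_rpow (by norm_num) h hβ.le
    have h2 : (t ^ 2 - 1 / 4) / 4 ≤ 1 := by nlinarith
    nlinarith

theorem le_integral_abs_two_mul_sin_rpow {β : ℝ} (hβ : 0 < β) {n k : ℝ} (hn : 0 < n)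
    (hk : 0 < k) : (1 / 4) ^ β / 8 / n * min 1 (k / n) ^ β ≤
      ∫ h in (0 : ℝ)..1 / n, |2 * Real.sin (k * h / 2)| ^ β := by
  have hint : ∀ a b, IntervalIntegrable (fun h : ℝ => |2 * Real.sin (k * h / 2)| ^ β) volume a b :=
    fun a b => (continuous_abs_two_mul_sin_rpow hβ k).intervalIntegrable a b
  have hn' : 0 < 1 / n := by positivity
  have hm0 : 0 ≤ min 1 (k / n) := by positivity
  rcases le_total k (2 * n) with hkn | hkn
  · have h1 : ∫ _ in 1 / (2 * n)..1 / n, (k / n / 4) ^ β ≤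
        ∫ h in 1 / (2 * n)..1 / n, |2 * Real.sin (k * h / 2)| ^ β := by
      refine intervalIntegral.integral_mono_on (by gcongr; linarith) (by simp) (hint _ _)
        fun h hh => Real.rpow_le_rpow (by positivity) ?_ hβ.le
      have hh0 : 0 < h := lt_of_lt_of_le (by positivity) hh.1
      have h2 : k * h / 2 ≤ 1 := by
        calc k * h / 2 ≤ 2 * n * (1 / n) / 2 := by gcongr; exact hh.2
          _ = 1 := by field_simp
      have h3 : 2 / π * (k * h / 2) ≤ Real.sin (k * h / 2) :=
        Real.mul_le_sin (by positivity) (by linarith [Real.pi_gt_three])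
      have h4 : (1 / 2 : ℝ) ≤ 2 / π := by
        rw [div_le_div_iff₀ two_pos pi_pos]; linarith [Real.pi_le_four]
      have h5 : 1 / 2 * (k * h / 2) ≤ Real.sin (k * h / 2) :=
        (mul_le_mul_of_nonneg_right h4 (by positivity)).trans h3
      have h6 : k / n / 4 ≤ k * h / 2 := by
        calc k / n / 4 = k * (1 / (2 * n)) / 2 := by field_simp; ring
          _ ≤ k * h / 2 := by gcongr; exact hh.1
      exact (by linarith : _ ≤ 2 * Real.sin (k * h / 2)).trans (le_abs_self _)
    have h7 : ∫ h in 1 / (2 * n)..1 / n, |2 * Real.sin (k * h / 2)| ^ β ≤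
        ∫ h in (0 : ℝ)..1 / n, |2 * Real.sin (k * h / 2)| ^ β :=
      intervalIntegral.integral_mono_interval (by positivity) (by gcongr; linarith) le_rfl
        (Filter.Eventually.of_forall fun h => by positivity) (hint _ _)
    refine le_trans ?_ (h1.trans h7)
    rw [intervalIntegral.integral_const, smul_eq_mul, div_eq_mul_one_div (k / n) 4,
      Real.mul_rpow (by positivity) (by positivity)]
    have h8 : min 1 (k / n) ^ β ≤ (k / n) ^ β := by gcongr; exact min_le_right _ _
    have h9 : (1 : ℝ) / n - 1 / (2 * n) = 1 / 2 / n := by field_simp; norm_num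
    rw [h9]
    calc (1 / 4) ^ β / 8 / n * min 1 (k / n) ^ β ≤ (1 / 4) ^ β / 2 / n * (k / n) ^ β := by
          gcongr; norm_num
      _ = _ := by ring
  · have h1 : ∫ h in (0 : ℝ)..1 / n, (1 / 2) ^ β * (((2 * Real.sin (k * h / 2)) ^ 2 - 1 / 4) / 4) ≤
        ∫ h in (0 : ℝ)..1 / n, |2 * Real.sin (k * h / 2)| ^ β := by
      refine intervalIntegral.integral_mono_on hn'.le
        (Continuous.intervalIntegrable (by fun_prop) _ _) (hint _ _) fun h _ => ?_
      rw [← sq_abs (2 * Real.sin (k * h / 2))]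
      refine rpow_ge_of_le_two hβ (abs_nonneg _) ?_
      rw [abs_mul, abs_two]
      linarith [Real.abs_sin_le_one (k * h / 2)]
    refine le_trans ?_ h1
    rw [intervalIntegral.integral_const_mul, intervalIntegral.integral_div,
      intervalIntegral.integral_sub (Continuous.intervalIntegrable (by fun_prop) _ _) (by simp),
      intervalIntegral_sq_two_mul_sin hk.ne', intervalIntegral.integral_const, smul_eq_mul]
    have h2 : 2 * Real.sin (k * (1 / n)) / k ≤ 1 / n := by
      rw [div_le_div_iff₀ hk hn]
      nlinarith [Real.sin_le_one (k * (1 / n))]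
    have h3 : min 1 (k / n) ^ β ≤ 1 := Real.rpow_le_one hm0 (min_le_left _ _) hβ.le
    have h4 : (1 / 4 : ℝ) ^ β ≤ (1 / 2) ^ β := by gcongr; norm_num
    calc (1 / 4) ^ β / 8 / n * min 1 (k / n) ^ β ≤ (1 / 2) ^ β / 8 / n * 1 := by gcongr
      _ = (1 / 2) ^ β * (1 / 8 * (1 / n)) := by ring
      _ ≤ _ := by gcongr; linarith

/-- The one-dimensional factor by which a fractional difference of step `h` multiplies the terms of
the weighted sum of the Fourier coefficients. -/
def diffWeight (s α h : ℝ) (k : ℤ) : ℝ :=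
  freqWeight k ^ (s - 2) * |2 * Real.sin (k * h / 2)| ^ (α * s)

theorem diffWeight_nonneg (s α h : ℝ) (k : ℤ) : 0 ≤ diffWeight s α h k := by
  have := freqWeight_pos k
  unfold diffWeight; positivity

theorem abs_two_mul_sin_natAbs (k : ℤ) (h : ℝ) :
    |2 * Real.sin (k.natAbs * h / 2)| = |2 * Real.sin (k * h / 2)| := by
  rcases Int.natAbs_eq k with hk | hk
  · conv_rhs => rw [hk]
    simp only [Int.cast_natCast]
  · conv_rhs => rw [hk]
    simp only [Int.cast_neg, Int.cast_natCast, neg_mul, neg_div, Real.sin_neg, mul_neg, abs_neg]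

theorem freqWeight_le_two_mul {k : ℤ} (hk : k ≠ 0) : freqWeight k ≤ 2 * k.natAbs := by
  have h1 : (1 : ℝ) ≤ k.natAbs := by exact_mod_cast Int.natAbs_pos.2 hk
  have h2 : |(k : ℝ)| = k.natAbs := by rw [Nat.cast_natAbs, Int.cast_abs]
  rw [freqWeight, h2]
  linarith

theorem diffWeight_le {s α h : ℝ} (hs : 2 ≤ s) (hα : 0 < α) {n : ℕ} (hn : 1 ≤ n)
    (hh : |h| ≤ 1 / n) {k : ℤ} (hk : k ≠ 0) :
    diffWeight s α h k ≤ 2 ^ (s - 2) * 2 ^ (α * s) * cutoffWeight s α n k.natAbs := by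
  have hn0 : (0 : ℝ) < n := by exact_mod_cast hn
  have h1 : |2 * Real.sin (k * h / 2)| ≤ 2 * min 1 ((k.natAbs : ℝ) / n) := by
    rw [← abs_two_mul_sin_natAbs, abs_mul, abs_two]
    refine mul_le_mul_of_nonneg_left (le_min (Real.abs_sin_le_one _) ?_) two_pos.le
    refine (Real.abs_sin_le_abs).trans ?_
    rw [abs_div, abs_mul, abs_two, Nat.abs_cast]
    calc (k.natAbs : ℝ) * |h| / 2 ≤ k.natAbs * (1 / n) / 1 := by gcongr; norm_num
      _ = _ := by ring
  have h2 : 0 ≤ min 1 ((k.natAbs : ℝ) / n) := by positivity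
  rw [diffWeight, cutoffWeight]
  calc freqWeight k ^ (s - 2) * |2 * Real.sin (k * h / 2)| ^ (α * s)
      ≤ (2 * k.natAbs) ^ (s - 2) * (2 * min 1 ((k.natAbs : ℝ) / n)) ^ (α * s) := by
        have := (freqWeight_pos k).le
        have := freqWeight_le_two_mul hk
        have : 0 ≤ s - 2 := by linarith
        gcongr
    _ = _ := by
        rw [Real.mul_rpow two_pos.le (by positivity), Real.mul_rpow two_pos.le h2]
        ring

theorem measurable_diffWeight {s α : ℝ} (hs : 0 < s) (hα : 0 < α) (k : ℤ) :
    Measurable fun h => ENNReal.ofReal (diffWeight s α h k) :=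
  ((continuous_abs_two_mul_sin_rpow (mul_pos hα hs) k).measurable.const_mul _).ennreal_ofReal

theorem le_lintegral_diffWeight {s α : ℝ} (hs : 0 < s) (hs2 : s ≤ 2) (hα : 0 < α) {n : ℕ}
    (hn : 1 ≤ n) {k : ℤ} (hk : k ≠ 0) :
    ENNReal.ofReal (1 / n) * ENNReal.ofReal (2 ^ (s - 2) * ((1 / 4) ^ (α * s) / 8) *
      cutoffWeight s α n k.natAbs) ≤
      ∫⁻ h in Set.Ioc (0 : ℝ) (1 / n), ENNReal.ofReal (diffWeight s α h k) := by
  have hn0 : (0 : ℝ) < n := by exact_mod_cast hn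
  have hk0 : (0 : ℝ) < k.natAbs := by exact_mod_cast Int.natAbs_pos.2 hk
  have hβ : 0 < α * s := mul_pos hα hs
  have hc : Continuous fun h => diffWeight s α h k :=
    (continuous_abs_two_mul_sin_rpow hβ k).const_mul _
  rw [← ofReal_integral_eq_lintegral_ofReal
      (hc.integrableOn_Icc.mono_set Set.Ioc_subset_Icc_self)
      (Filter.Eventually.of_forall fun h => diffWeight_nonneg s α h k),
    ← intervalIntegral.integral_of_le (by positivity), ← ENNReal.ofReal_mul (by positivity)]
  refine ENNReal.ofReal_le_ofReal ?_
  simp only [diffWeight]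
  rw [intervalIntegral.integral_const_mul]
  simp_rw [← abs_two_mul_sin_natAbs]
  have h1 := le_integral_abs_two_mul_sin_rpow hβ hn0 hk0
  have h2 : (2 * (k.natAbs : ℝ)) ^ (s - 2) ≤ freqWeight k ^ (s - 2) :=
    Real.rpow_le_rpow_of_nonpos (freqWeight_pos k) (freqWeight_le_two_mul hk) (by linarith)
  calc _ = (2 * (k.natAbs : ℝ)) ^ (s - 2) *
        ((1 / 4) ^ (α * s) / 8 / n * min 1 ((k.natAbs : ℝ) / n) ^ (α * s)) := by
        rw [cutoffWeight, Real.mul_rpow two_pos.le hk0.le]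
        ring
    _ ≤ _ := mul_le_mul h2 h1 (by positivity) (Real.rpow_nonneg (freqWeight_pos k).le _)

end SineAverage

section Comparison

open AddCircle

attribute [local instance] fact_two_pi_pos

theorem tsum_int_le_two_mul_tsum_nat {F : ℤ → ℝ≥0∞} {g : ℕ → ℝ≥0∞} (h0 : F 0 = 0)
    (hF : ∀ k, F k ≤ g k.natAbs) : ∑' k, F k ≤ 2 * ∑' i, g (i + 1) := by
  rw [tsum_of_nat_of_neg_add_one ENNReal.summable ENNReal.summable,
    tsum_eq_zero_add' ENNReal.summable, Nat.cast_zero, h0, zero_add, two_mul]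
  gcongr with i i
  · exact hF _
  · refine (hF _).trans_eq (congrArg g ?_)
    omega

theorem tsum_int_int_le_four_mul_tsum_nat_nat {F : ℤ → ℤ → ℝ≥0∞} {g : ℕ → ℕ → ℝ≥0∞}
    (hl : ∀ l, F 0 l = 0) (hr : ∀ k, F k 0 = 0) (hF : ∀ k l, F k l ≤ g k.natAbs l.natAbs) :
    ∑' (k) (l), F k l ≤ 4 * ∑' (i) (j), g (i + 1) (j + 1) := by
  calc ∑' (k) (l), F k l ≤ 2 * ∑' i : ℕ, 2 * ∑' j, g (i + 1) (j + 1) := by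
        refine tsum_int_le_two_mul_tsum_nat (g := fun i => 2 * ∑' j, g i (j + 1)) (by simp [hl])
          fun k => ?_
        exact tsum_int_le_two_mul_tsum_nat (hr k) (hF k)
    _ = _ := by rw [ENNReal.tsum_mul_left, ← mul_assoc]; norm_num

theorem tsum_nat_nat_comp_le_tsum_int_int (F : ℤ → ℤ → ℝ≥0∞) {a b : ℕ → ℤ}
    (ha : Function.Injective a) (hb : Function.Injective b) :
    ∑' (i) (j), F (a i) (b j) ≤ ∑' (k) (l), F k l :=
  (ENNReal.tsum_le_tsum fun i =>
    ENNReal.tsum_comp_le_tsum_of_injective hb (F (a i))).trans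
    (ENNReal.tsum_comp_le_tsum_of_injective ha fun k => ∑' l, F k l)

theorem tsum_nat_nat_le_four_mul_tsum_int_int {g : ℕ → ℕ → ℝ≥0∞} {F : ℤ → ℤ → ℝ≥0∞}
    (hg : ∀ m n : ℕ, 0 < m → 0 < n → g m n ≤ F m n + F (-m) n + F m (-n) + F (-m) (-n)) :
    ∑' (i) (j), g (i + 1) (j + 1) ≤ 4 * ∑' (k) (l), F k l := by
  have hp : Function.Injective fun i : ℕ => ((i + 1 : ℕ) : ℤ) := fun i j h => by
    simpa using h
  have hn : Function.Injective fun i : ℕ => -((i + 1 : ℕ) : ℤ) := fun i j h => by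
    simpa using h
  have h4 : ∀ a : ℝ≥0∞, 4 * a = a + a + a + a := fun a => by ring
  refine (ENNReal.tsum_le_tsum fun i => ENNReal.tsum_le_tsum fun j =>
    hg (i + 1) (j + 1) i.succ_pos j.succ_pos).trans ?_
  simp_rw [ENNReal.tsum_add]
  rw [h4]
  gcongr
  · exact tsum_nat_nat_comp_le_tsum_int_int F hp hp
  · exact tsum_nat_nat_comp_le_tsum_int_int F hn hp
  · exact tsum_nat_nat_comp_le_tsum_int_int F hp hn
  · exact tsum_nat_nat_comp_le_tsum_int_int F hn hn

variable {f : ℝ → ℝ → ℝ} {p α₁ α₂ s : ℝ} {n₁ n₂ : ℕ}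

theorem rpow_add_four_le (hs : 0 < s) {a b c d : ℝ} (ha : 0 ≤ a) (hb : 0 ≤ b) (hc : 0 ≤ c)
    (hd : 0 ≤ d) : (4 * (a + b + c + d)) ^ s ≤ 16 ^ s * (a ^ s + b ^ s + c ^ s + d ^ s) := by
  have ha' := Real.rpow_nonneg ha s
  have hb' := Real.rpow_nonneg hb s
  have hc' := Real.rpow_nonneg hc s
  have hd' := Real.rpow_nonneg hd s
  have key : ∀ x, 0 ≤ x → a ≤ x → b ≤ x → c ≤ x → d ≤ x →
      x ^ s ≤ a ^ s + b ^ s + c ^ s + d ^ s →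
      (4 * (a + b + c + d)) ^ s ≤ 16 ^ s * (a ^ s + b ^ s + c ^ s + d ^ s) := by
    intro x hx hax hbx hcx hdx h
    calc (4 * (a + b + c + d)) ^ s ≤ (16 * x) ^ s :=
          Real.rpow_le_rpow (by positivity) (by linarith) hs.le
      _ = 16 ^ s * x ^ s := Real.mul_rpow (by norm_num) hx
      _ ≤ _ := by gcongr
  have hm : 0 ≤ max (max a b) (max c d) := le_max_of_le_left (le_max_of_le_left ha)
  refine key (max (max a b) (max c d)) hm (by simp) (by simp) (by simp) (by simp) ?_
  rcases max_choice (max a b) (max c d) with h | h <;> rw [h]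
  · rcases max_choice a b with h | h <;> rw [h] <;> linarith
  · rcases max_choice c d with h | h <;> rw [h] <;> linarith

theorem cutoffSum_le_tsum (hs : 0 < s) (hf : IsBiperiodic f)
    (hi : Integrable (torusLift f) (haarAddCircle.prod haarAddCircle)) :
    cutoffSum f α₁ α₂ n₁ n₂ s ≤ 4 * (ENNReal.ofReal (16 ^ s) *
      ∑' (k : ℤ) (l : ℤ), ENNReal.ofReal (cutoffWeight s α₁ n₁ k.natAbs *
        cutoffWeight s α₂ n₂ l.natAbs * ‖torusCoeff (torusLift f) k l‖ ^ s)) := by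
  simp_rw [← ENNReal.tsum_mul_left]
  rw [cutoffSum]
  simp_rw [ENNReal.tsum_mul_left (a := (4 : ℝ≥0∞))]
  refine tsum_nat_nat_le_four_mul_tsum_int_int fun m n _ _ => ?_
  have hw := mul_nonneg (cutoffWeight_nonneg s α₁ n₁ m) (cutoffWeight_nonneg s α₂ n₂ n)
  have hρ := Real.rpow_le_rpow (rhoCoef_nonneg f m n) (rhoCoef_le hf hi m n) hs.le
  have h4 := hρ.trans (rpow_add_four_le hs (norm_nonneg _) (norm_nonneg _) (norm_nonneg _)
    (norm_nonneg _))
  simp only [Int.natAbs_neg, Int.natAbs_natCast]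
  rw [← mul_add, ← mul_add, ← mul_add, ← ENNReal.ofReal_add (by positivity) (by positivity),
    ← ENNReal.ofReal_add (by positivity) (by positivity),
    ← ENNReal.ofReal_add (by positivity) (by positivity), ← ENNReal.ofReal_mul (by positivity)]
  refine ENNReal.ofReal_le_ofReal ((mul_le_mul_of_nonneg_left h4 hw).trans_eq ?_)
  ring

theorem integrable_torusLift_diffX_diffY (hp : 1 < p) (hf : MemLp0 p f) (hα₁ : 0 < α₁)
    (hα₂ : 0 < α₂) (h₁ h₂ : ℝ) : Integrable (torusLift (diffX α₁ h₁ (diffY α₂ h₂ f)))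
      (haarAddCircle.prod haarAddCircle) :=
  integrable_torusLift_diffX (hf.isBiperiodic.diffY _ _)
    (integrable_torusLift_diffY hf.isBiperiodic (hf.integrable_torusLift hp) hα₂ _) hα₁ _

theorem torusSum_diffX_diffY (hs : 0 < s) (hp : 1 < p) (hf : MemLp0 p f) (hα₁ : 0 < α₁)
    (hα₂ : 0 < α₂) (h₁ h₂ : ℝ) :
    torusSum s (torusCoeff (torusLift (diffX α₁ h₁ (diffY α₂ h₂ f)))) =
      ∑' (k : ℤ) (l : ℤ), ENNReal.ofReal (diffWeight s α₁ h₁ k) *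
        (ENNReal.ofReal (diffWeight s α₂ h₂ l) *
          ENNReal.ofReal (‖torusCoeff (torusLift f) k l‖ ^ s)) := by
  refine tsum_congr fun k => tsum_congr fun l => ?_
  have hi := hf.integrable_torusLift hp
  have hk := (freqWeight_pos k).le
  have hl := (freqWeight_pos l).le
  rw [← ofReal_norm, norm_torusCoeff_diffX (hf.isBiperiodic.diffY _ _)
    (integrable_torusLift_diffY hf.isBiperiodic hi hα₂ _) hα₁,
    norm_torusCoeff_diffY hf.isBiperiodic hi hα₂,
    ENNReal.ofReal_rpow_of_nonneg (by positivity) hs.le,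
    ← ENNReal.ofReal_mul (by positivity), ← ENNReal.ofReal_mul (by positivity),
    ← ENNReal.ofReal_mul (diffWeight_nonneg _ _ _ _),
    ← ENNReal.ofReal_mul (diffWeight_nonneg _ _ _ _), Real.mul_rpow (by positivity) (by positivity),
    Real.mul_rpow (by positivity) (by positivity), ← Real.rpow_mul (abs_nonneg _),
    ← Real.rpow_mul (abs_nonneg _), diffWeight, diffWeight]
  congr 1
  ring

theorem exists_torusSum_diff_le_cutoffSum (hs : 2 ≤ s) (hp : 1 < p) (hα₁ : 0 < α₁)
    (hα₂ : 0 < α₂) : ∃ C : ℝ, 0 < C ∧ ∀ (f : ℝ → ℝ → ℝ) (n₁ n₂ : ℕ), 1 ≤ n₁ → 1 ≤ n₂ →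
      MemLp0 p f → ∀ h₁ h₂ : ℝ, |h₁| ≤ 1 / n₁ → |h₂| ≤ 1 / n₂ →
      torusSum s (torusCoeff (torusLift (diffX α₁ h₁ (diffY α₂ h₂ f)))) ≤
        ENNReal.ofReal C * cutoffSum f α₁ α₂ n₁ n₂ s := by
  have hs0 : 0 < s := by linarith
  set A : ℝ := 2 ^ (s - 2) * 2 ^ (α₁ * s) with hA
  set B : ℝ := 2 ^ (s - 2) * 2 ^ (α₂ * s) with hB
  have hA0 : 0 < A := by positivity
  have hB0 : 0 < B := by positivity
  refine ⟨4 * (A * B), by positivity, fun f n₁ n₂ hn₁ hn₂ hf h₁ h₂ hh₁ hh₂ => ?_⟩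
  rw [torusSum_diffX_diffY hs0 hp hf hα₁ hα₂, ENNReal.ofReal_mul (by norm_num), mul_assoc,
    cutoffSum, ENNReal.ofReal_ofNat]
  simp_rw [← ENNReal.tsum_mul_left (a := ENNReal.ofReal (A * B))]
  have hi := hf.integrable_torusLift hp
  refine tsum_int_int_le_four_mul_tsum_nat_nat (g := fun m n => ENNReal.ofReal (A * B) *
    cutoffTerm f α₁ α₂ n₁ n₂ s m n) (fun l => ?_) (fun k => ?_) fun k l => ?_
  · rw [torusCoeff_zero_left hp hf, norm_zero, Real.zero_rpow hs0.ne']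
    simp
  · rw [torusCoeff_zero_right hp hf, norm_zero, Real.zero_rpow hs0.ne']
    simp
  rcases eq_or_ne k 0 with rfl | hk
  · rw [torusCoeff_zero_left hp hf, norm_zero, Real.zero_rpow hs0.ne']
    simp
  rcases eq_or_ne l 0 with rfl | hl
  · rw [torusCoeff_zero_right hp hf, norm_zero, Real.zero_rpow hs0.ne']
    simp
  have hw₁ := cutoffWeight_nonneg s α₁ n₁ k.natAbs
  have hw₂ := cutoffWeight_nonneg s α₂ n₂ l.natAbs
  have hd₁ := diffWeight_nonneg s α₁ h₁ k
  have hd₂ := diffWeight_nonneg s α₂ h₂ l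
  rw [cutoffTerm, ← ENNReal.ofReal_mul hd₂, ← ENNReal.ofReal_mul hd₁,
    ← ENNReal.ofReal_mul (by positivity)]
  refine ENNReal.ofReal_le_ofReal ?_
  calc diffWeight s α₁ h₁ k * (diffWeight s α₂ h₂ l * ‖torusCoeff (torusLift f) k l‖ ^ s)
      ≤ (A * cutoffWeight s α₁ n₁ k.natAbs) * ((B * cutoffWeight s α₂ n₂ l.natAbs) *
        rhoCoef f k.natAbs l.natAbs ^ s) := by
        gcongr
        · exact diffWeight_le hs hα₁ hn₁ hh₁ hk
        · exact diffWeight_le hs hα₂ hn₂ hh₂ hl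
        · exact norm_torusCoeff_le_rhoCoef hf.isBiperiodic hi k l
    _ = _ := by ring

theorem exists_mixedMod_le_Ifun (hp : 1 < p) (hα₁ : 0 < α₁) (hα₂ : 0 < α₂) :
    ∃ C : ℝ, 0 < C ∧ ∀ (f : ℝ → ℝ → ℝ) (n₁ n₂ : ℕ), 1 ≤ n₁ → 1 ≤ n₂ → MemLp0 p f →
      mixedMod p α₁ α₂ (1 / (n₁ : ℝ)) (1 / (n₂ : ℝ)) f ≤
        ENNReal.ofReal C * Ifun f α₁ α₂ n₁ n₂ (max 2 p) := by
  have hs : 2 ≤ max 2 p := le_max_left 2 p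
  obtain ⟨C₁, hC₁, h1⟩ := exists_eLpNorm_le_torusSum (T := 2 * π) hp
  obtain ⟨C₂, hC₂, h2⟩ := exists_torusSum_diff_le_cutoffSum hs hp hα₁ hα₂
  generalize max 2 p = s at *
  have hs0 : 0 ≤ 1 / s := by positivity
  refine ⟨(2 * π) ^ (2 / p) * (C₁ * C₂ ^ (1 / s)), by positivity, fun f n₁ n₂ hn₁ hn₂ hf => ?_⟩
  refine iSup_le fun h₁ => iSup_le fun hh₁ => iSup_le fun h₂ => iSup_le fun hh₂ => ?_
  have hi := integrable_torusLift_diffX_diffY hp hf hα₁ hα₂ h₁ h₂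
  rw [Lp2Norm_eq ((hf.isBiperiodic.diffY _ _).diffX _ _) (by linarith) hi.aestronglyMeasurable,
    ENNReal.ofReal_mul (by positivity), ENNReal.ofReal_mul (by positivity), mul_assoc, mul_assoc]
  gcongr
  refine (h1 _ hi).trans ?_
  gcongr
  refine (ENNReal.rpow_le_rpow (h2 f n₁ n₂ hn₁ hn₂ hf h₁ h₂ hh₁ hh₂) hs0).trans ?_
  rw [ENNReal.mul_rpow_of_nonneg _ _ hs0, ENNReal.ofReal_rpow_of_nonneg hC₂.le hs0]
  gcongr
  exact cutoffSum_le_Ifun (by linarith) hn₁ hn₂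

theorem tsum_lintegral_mul_le {μ ν : Measure ℝ} {A B : ℝ → ℤ → ℝ≥0∞} {c : ℤ → ℤ → ℝ≥0∞}
    (hA : ∀ k, Measurable fun h => A h k) (hB : ∀ l, Measurable fun h => B h l) :
    ∑' (k) (l), (∫⁻ h, A h k ∂μ) * ((∫⁻ h, B h l ∂ν) * c k l) =
      ∫⁻ h₁, ∫⁻ h₂, ∑' (k) (l), A h₁ k * (B h₂ l * c k l) ∂ν ∂μ := by
  have h1 : ∀ h₁, ∫⁻ h₂, ∑' (k) (l), A h₁ k * (B h₂ l * c k l) ∂ν =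
      ∑' (k) (l), A h₁ k * ((∫⁻ h₂, B h₂ l ∂ν) * c k l) := fun h₁ => by
    rw [lintegral_tsum fun k => (Measurable.tsum fun l =>
      ((hB l).mul_const _).const_mul _).aemeasurable]
    refine tsum_congr fun k => ?_
    rw [lintegral_tsum fun l => (((hB l).mul_const _).const_mul _).aemeasurable]
    refine tsum_congr fun l => ?_
    rw [lintegral_const_mul _ ((hB l).mul_const _), lintegral_mul_const _ (hB l)]
  simp_rw [h1]
  rw [lintegral_tsum fun k => (Measurable.tsum fun l =>
    (hA k).mul_const _).aemeasurable]
  refine tsum_congr fun k => ?_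
  rw [lintegral_tsum fun l => ((hA k).mul_const _).aemeasurable]
  exact tsum_congr fun l => (lintegral_mul_const _ (hA k)).symm

theorem exists_cutoffSum_le (hs : 0 < s) (hs2 : s ≤ 2) (hp : 1 < p) (hα₁ : 0 < α₁)
    (hα₂ : 0 < α₂) : ∃ C : ℝ, 0 < C ∧ ∀ (f : ℝ → ℝ → ℝ) (n₁ n₂ : ℕ), 1 ≤ n₁ → 1 ≤ n₂ →
      MemLp0 p f → ∀ M : ℝ≥0∞, (∀ h₁ h₂ : ℝ, |h₁| ≤ 1 / n₁ → |h₂| ≤ 1 / n₂ →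
      torusSum s (torusCoeff (torusLift (diffX α₁ h₁ (diffY α₂ h₂ f)))) ≤ M) →
        cutoffSum f α₁ α₂ n₁ n₂ s ≤ ENNReal.ofReal C * M := by
  set A : ℝ := 2 ^ (s - 2) * ((1 / 4) ^ (α₁ * s) / 8) with hA
  set B : ℝ := 2 ^ (s - 2) * ((1 / 4) ^ (α₂ * s) / 8) with hB
  have hA0 : 0 < A := by positivity
  have hB0 : 0 < B := by positivity
  refine ⟨4 * (16 ^ s * (A * B)⁻¹), by positivity, fun f n₁ n₂ hn₁ hn₂ hf M hM => ?_⟩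
  have hn₁0 : (0 : ℝ) < n₁ := by exact_mod_cast hn₁
  have hn₂0 : (0 : ℝ) < n₂ := by exact_mod_cast hn₂
  set c := torusCoeff (torusLift f) with hc
  set S := ∑' (k : ℤ) (l : ℤ), ENNReal.ofReal (cutoffWeight s α₁ n₁ k.natAbs *
        cutoffWeight s α₂ n₂ l.natAbs * ‖c k l‖ ^ s) with hS
  have h1 : ENNReal.ofReal (1 / n₁) * ENNReal.ofReal (1 / n₂) * (ENNReal.ofReal (A * B) * S) ≤
      ENNReal.ofReal (1 / n₁) * ENNReal.ofReal (1 / n₂) * M := by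
    calc ENNReal.ofReal (1 / n₁) * ENNReal.ofReal (1 / n₂) * (ENNReal.ofReal (A * B) * S)
        ≤ ∑' (k : ℤ) (l : ℤ),
          (∫⁻ h in Set.Ioc (0 : ℝ) (1 / n₁), ENNReal.ofReal (diffWeight s α₁ h k)) *
          ((∫⁻ h in Set.Ioc (0 : ℝ) (1 / n₂), ENNReal.ofReal (diffWeight s α₂ h l)) *
            ENNReal.ofReal (‖c k l‖ ^ s)) := by
          rw [hS]
          simp_rw [← ENNReal.tsum_mul_left]
          refine ENNReal.tsum_le_tsum fun k => ENNReal.tsum_le_tsum fun l => ?_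
          rcases eq_or_ne k 0 with rfl | hk
          · rw [hc, torusCoeff_zero_left hp hf, norm_zero, Real.zero_rpow hs.ne']
            simp
          rcases eq_or_ne l 0 with rfl | hl
          · rw [hc, torusCoeff_zero_right hp hf, norm_zero, Real.zero_rpow hs.ne']
            simp
          have hw₁ := cutoffWeight_nonneg s α₁ n₁ k.natAbs
          have hw₂ := cutoffWeight_nonneg s α₂ n₂ l.natAbs
          refine le_trans (le_of_eq ?_) (mul_le_mul' (le_lintegral_diffWeight hs hs2 hα₁ hn₁ hk)
            (mul_le_mul_left (le_lintegral_diffWeight hs hs2 hα₂ hn₂ hl) _))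
          rw [← hA, ← hB]
          rw [← ENNReal.ofReal_mul (by positivity), ← ENNReal.ofReal_mul (by positivity),
            ← ENNReal.ofReal_mul (by positivity), ← ENNReal.ofReal_mul (by positivity),
            ← ENNReal.ofReal_mul (by positivity), ← ENNReal.ofReal_mul (by positivity),
            ← ENNReal.ofReal_mul (by positivity)]
          congr 1
          ring
      _ = ∫⁻ h₁ in Set.Ioc (0 : ℝ) (1 / n₁), ∫⁻ h₂ in Set.Ioc (0 : ℝ) (1 / n₂),
          torusSum s (torusCoeff (torusLift (diffX α₁ h₁ (diffY α₂ h₂ f)))) := by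
          rw [tsum_lintegral_mul_le (measurable_diffWeight hs hα₁) (measurable_diffWeight hs hα₂)]
          simp_rw [torusSum_diffX_diffY hs hp hf hα₁ hα₂, hc]
      _ ≤ ∫⁻ _ in Set.Ioc (0 : ℝ) (1 / n₁), ∫⁻ _ in Set.Ioc (0 : ℝ) (1 / n₂), M := by
          refine setLIntegral_mono measurable_const fun h₁ hh₁ =>
            setLIntegral_mono measurable_const fun h₂ hh₂ => hM h₁ h₂ ?_ ?_
          · rw [abs_of_pos hh₁.1]; exact hh₁.2
          · rw [abs_of_pos hh₂.1]; exact hh₂.2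
      _ = _ := by
          simp only [setLIntegral_const, Real.volume_Ioc, sub_zero]
          ring
  have h2 : ENNReal.ofReal (A * B) * S ≤ M := by
    rwa [ENNReal.mul_le_mul_iff_right (mul_ne_zero (by simp; omega) (by simp; omega))
      (ENNReal.mul_ne_top ENNReal.ofReal_ne_top ENNReal.ofReal_ne_top)] at h1
  have h3 : S ≤ ENNReal.ofReal (A * B)⁻¹ * M := by
    calc S = ENNReal.ofReal (A * B)⁻¹ * (ENNReal.ofReal (A * B) * S) := by
          rw [← mul_assoc, ← ENNReal.ofReal_mul (by positivity),
            inv_mul_cancel₀ (by positivity), ENNReal.ofReal_one, one_mul]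
      _ ≤ _ := by gcongr
  refine (cutoffSum_le_tsum hs hf.isBiperiodic (hf.integrable_torusLift hp)).trans ?_
  rw [ENNReal.ofReal_mul (by norm_num), ENNReal.ofReal_mul (by positivity), ENNReal.ofReal_ofNat,
    mul_assoc, mul_assoc]
  gcongr

theorem exists_Ifun_le_mixedMod (hp : 1 < p) (hα₁ : 0 < α₁) (hα₂ : 0 < α₂) :
    ∃ C : ℝ, 0 < C ∧ ∀ (f : ℝ → ℝ → ℝ) (n₁ n₂ : ℕ), 1 ≤ n₁ → 1 ≤ n₂ → MemLp0 p f →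
      Ifun f α₁ α₂ n₁ n₂ (min 2 p) ≤
        ENNReal.ofReal C * mixedMod p α₁ α₂ (1 / (n₁ : ℝ)) (1 / (n₂ : ℝ)) f := by
  have hs : 0 < min 2 p := lt_min two_pos (by linarith)
  obtain ⟨C₁, hC₁, h1⟩ := exists_torusSum_le_eLpNorm (T := 2 * π) hp
  obtain ⟨C₂, hC₂, h2⟩ := exists_cutoffSum_le hs (min_le_left 2 p) hp hα₁ hα₂
  generalize min 2 p = s at *
  have hs0 : 0 ≤ 1 / s := by positivity
  set D : ℝ := (2 * π) ^ (2 / p) with hD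
  have hD0 : 0 < D := by positivity
  refine ⟨4 * (C₂ ^ (1 / s) * (C₁ * D⁻¹)), by positivity, fun f n₁ n₂ hn₁ hn₂ hf => ?_⟩
  set ω := mixedMod p α₁ α₂ (1 / (n₁ : ℝ)) (1 / (n₂ : ℝ)) f with hω
  have hM : cutoffSum f α₁ α₂ n₁ n₂ s ≤
      ENNReal.ofReal C₂ * (ENNReal.ofReal (C₁ * D⁻¹) * ω) ^ s := by
    refine h2 f n₁ n₂ hn₁ hn₂ hf _ fun h₁ h₂ hh₁ hh₂ => ?_
    have hi := integrable_torusLift_diffX_diffY hp hf hα₁ hα₂ h₁ h₂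
    have h3 : Lp2Norm p (diffX α₁ h₁ (diffY α₂ h₂ f)) ≤ ω :=
      le_iSup_of_le h₁ (le_iSup_of_le hh₁ (le_iSup_of_le h₂ (le_iSup_of_le hh₂ le_rfl)))
    rw [Lp2Norm_eq ((hf.isBiperiodic.diffY _ _).diffX _ _) (by linarith)
      hi.aestronglyMeasurable] at h3
    rw [← ENNReal.rpow_le_rpow_iff (z := 1 / s) (by positivity), ← ENNReal.rpow_mul,
      mul_one_div_cancel hs.ne', ENNReal.rpow_one]
    refine (h1 _ hi).trans ?_
    rw [ENNReal.ofReal_mul hC₁.le, mul_assoc]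
    gcongr
    calc eLpNorm' (torusLift (diffX α₁ h₁ (diffY α₂ h₂ f))) p
          (haarAddCircle.prod haarAddCircle) = ENNReal.ofReal D⁻¹ * (ENNReal.ofReal D *
            eLpNorm' (torusLift (diffX α₁ h₁ (diffY α₂ h₂ f))) p
              (haarAddCircle.prod haarAddCircle)) := by
          rw [← mul_assoc, ← ENNReal.ofReal_mul (by positivity),
            inv_mul_cancel₀ hD0.ne', ENNReal.ofReal_one, one_mul]
      _ ≤ _ := by gcongr
  refine (Ifun_le_cutoffSum hs hn₁ hn₂).trans ?_
  rw [ENNReal.ofReal_mul (by norm_num), ENNReal.ofReal_mul (by positivity), ENNReal.ofReal_ofNat,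
    mul_assoc, mul_assoc]
  gcongr
  refine (ENNReal.rpow_le_rpow hM hs0).trans_eq ?_
  rw [ENNReal.mul_rpow_of_nonneg _ _ hs0, ← ENNReal.rpow_mul, mul_one_div_cancel hs.ne',
    ENNReal.rpow_one, ENNReal.ofReal_rpow_of_nonneg hC₂.le hs0]

end Comparison

/-- Two-sided estimate of the mixed modulus of smoothness via Fourier coefficients. -/
theorem modulus_vs_fourier_coefficients (p α₁ α₂ : ℝ) (hp : 1 < p)
    (hα₁ : 0 < α₁) (hα₂ : 0 < α₂) :
    ∃ C : ℝ, 0 < C ∧ ∀ (f : ℝ → ℝ → ℝ) (n₁ n₂ : ℕ), 1 ≤ n₁ → 1 ≤ n₂ → MemLp0 p f →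
      Ifun f α₁ α₂ n₁ n₂ (min 2 p) ≤
          ENNReal.ofReal C * mixedMod p α₁ α₂ (1/(n₁:ℝ)) (1/(n₂:ℝ)) f ∧
      mixedMod p α₁ α₂ (1/(n₁:ℝ)) (1/(n₂:ℝ)) f ≤
          ENNReal.ofReal C * Ifun f α₁ α₂ n₁ n₂ (max 2 p) := by
  obtain ⟨C₁, hC₁, h₁⟩ := exists_Ifun_le_mixedMod hp hα₁ hα₂
  obtain ⟨C₂, hC₂, h₂⟩ := exists_mixedMod_le_Ifun hp hα₁ hα₂
  refine ⟨C₁ + C₂, by positivity, fun f n₁ n₂ hn₁ hn₂ hf =>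
    ⟨(h₁ f n₁ n₂ hn₁ hn₂ hf).trans ?_, (h₂ f n₁ n₂ hn₁ hn₂ hf).trans ?_⟩⟩
  · gcongr
    linarith
  · gcongr
    linarith

end
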